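/- arXiv:1601.07887 — 3 statements merged into one kernel-verified Lean document; each statement's English description precedes it below -/
import Mathlib

section
/- Under the setup below, there exist real numbers ρ_0, ρ_1, …, ρ_{2n}, depending only on n and the derivatives f^{(k)}(γ) for 2 ≤ k ≤ 2n+2, with ρ_0 = 1 and |ρ_k| ≤ C/M^k for 1 ≤ k ≤ 2n, such that for all y with |y| ≤ min(r_1, r_2, Δ M) one has dx/dy (y) = Σ_{k=0}^{2n} ρ_k y^k + O( |y|^{2n+1}/M^{2n+1} ), where x(y) is the inverse of the change of variable and dx/dy its derivative; C and the implied constant depend only on n and C_2, …, C_{2n+3}. -/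
namespace WSP
open Set Filter Topology

lemma taylor_two_sided {s : Set ℝ} (hs : Convex ℝ s) {x0 : ℝ} (hx0 : x0 ∈ s) (N : ℕ) :
    ∀ (F : ℕ → ℝ → ℝ) (B : ℝ),
      (∀ i < N, ∀ x ∈ s, HasDerivWithinAt (F i) (F (i + 1) x) s x) →
      (∀ x ∈ s, |F N x| ≤ B) → ∀ x ∈ s,
      |F 0 x - ∑ i ∈ Finset.range N, F i x0 / (i.factorial : ℝ) * (x - x0) ^ i|
        ≤ B * |x - x0| ^ N := by
  induction N with
  | zero => intro F B _ hB x hx; simpa using hB x hx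
  | succ N ih =>
    intro F B hF hB x hx
    have hB0 : 0 ≤ B := (abs_nonneg _).trans (hB x hx)
    have h1 := ih (fun i => F (i + 1)) B (fun i hi x hx => hF (i + 1) (by omega) x hx) hB
    set t : Set ℝ := s ∩ Metric.closedBall x0 |x - x0| with ht
    have htc : Convex ℝ t := hs.inter (convex_closedBall _ _)
    have hder : ∀ z ∈ t, HasDerivWithinAt
        (fun z => F 0 z - ∑ i ∈ Finset.range (N + 1), F i x0 / (i.factorial : ℝ) * (z - x0) ^ i)
        (F 1 z - ∑ i ∈ Finset.range N, F (i + 1) x0 / (i.factorial : ℝ) * (z - x0) ^ i) t z := by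
      intro z hz
      refine ((hF 0 (by omega) z hz.1).mono inter_subset_left).sub ?_
      have h2 : ∀ i ∈ Finset.range (N + 1), HasDerivAt
          (fun z : ℝ => F i x0 / (i.factorial : ℝ) * (z - x0) ^ i)
          (F i x0 / (i.factorial : ℝ) * (i * (z - x0) ^ (i - 1))) z := by
        intro i _
        have := (((hasDerivAt_id z).sub_const x0).pow i).const_mul (F i x0 / (i.factorial : ℝ))
        simpa using this
      have h3 := HasDerivAt.fun_sum h2
      refine (h3.congr_deriv ?_).hasDerivWithinAt
      rw [Finset.sum_range_succ']
      simp only [Nat.cast_zero, zero_mul, mul_zero, add_zero]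
      refine Finset.sum_congr rfl fun i _ => ?_
      have : (i.factorial : ℝ) ≠ 0 := by positivity
      have : ((i : ℝ) + 1) ≠ 0 := by positivity
      rw [Nat.factorial_succ]; push_cast
      field_simp
    have hbd : ∀ z ∈ t, ‖F 1 z - ∑ i ∈ Finset.range N,
        F (i + 1) x0 / (i.factorial : ℝ) * (z - x0) ^ i‖ ≤ B * |x - x0| ^ N := by
      intro z hz
      refine (h1 z hz.1).trans ?_
      have : |z - x0| ≤ |x - x0| := by simpa [Real.dist_eq] using hz.2
      gcongr
    have hxt : x ∈ t := ⟨hx, by simp [Real.dist_eq]⟩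
    have h0t : x0 ∈ t := ⟨hx0, by simp⟩
    have key := htc.norm_image_sub_le_of_norm_hasDerivWithin_le hder hbd h0t hxt
    have hz : F 0 x0 - ∑ i ∈ Finset.range (N + 1), F i x0 / (i.factorial : ℝ) * (x0 - x0) ^ i
        = 0 := by
      rw [Finset.sum_range_succ']; simp
    rw [hz, sub_zero, Real.norm_eq_abs, Real.norm_eq_abs] at key
    rw [pow_succ, ← mul_assoc]; exact key

lemma hasDeriv_iter {a b : ℝ} (hab : a < b) {N : ℕ} {f : ℝ → ℝ}
    (hf : ContDiffOn ℝ N f (Icc a b)) {i : ℕ} (hi : i < N) {x : ℝ} (hx : x ∈ Icc a b) :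
    HasDerivWithinAt (iteratedDerivWithin i f (Icc a b))
      (iteratedDerivWithin (i + 1) f (Icc a b) x) (Icc a b) x := by
  rw [iteratedDerivWithin_succ]
  exact ((hf.differentiableOn_iteratedDerivWithin (by exact_mod_cast hi)
    (uniqueDiffOn_Icc hab)) x hx).hasDerivWithinAt

lemma smooth_expand {a b : ℝ} (ha : a < 1) (hb : 1 < b) {N : ℕ} {f : ℝ → ℝ}
    (hf : ContDiffOn ℝ N f (Icc a b)) :
    ∃ (c : ℕ → ℝ) (K : ℝ), ∀ x ∈ Icc a b,
      |f x - ∑ i ∈ Finset.range N, c i * (x - 1) ^ i| ≤ K * |x - 1| ^ N := by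
  have hab := ha.trans hb
  obtain ⟨K, hK⟩ := isCompact_Icc.exists_bound_of_continuousOn
    (hf.continuousOn_iteratedDerivWithin le_rfl (uniqueDiffOn_Icc hab))
  refine ⟨fun i => iteratedDerivWithin i f (Icc a b) 1 / (i.factorial : ℝ), K, fun x hx => ?_⟩
  have := taylor_two_sided (convex_Icc a b) (x0 := 1) ⟨ha.le, hb.le⟩ N
    (fun i => iteratedDerivWithin i f (Icc a b)) K
    (fun i hi x hx => hasDeriv_iter hab hf hi hx) hK x hx
  simpa using this

section E
variable {Ω : Type} (S : Ω → Set ℝ)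

/-- uniformly bounded -/
def Bd (g : Ω → ℝ → ℝ) : Prop := ∃ K : ℝ, ∀ ω, ∀ y ∈ S ω, |g ω y| ≤ K

/-- uniform expansion to order `m` at `0` -/
def Ex : ℕ → (Ω → ℝ → ℝ) → Prop
  | 0, g => Bd S g
  | m + 1, g => ∃ (a : Ω → ℝ) (r : Ω → ℝ → ℝ), (∃ K : ℝ, ∀ ω, |a ω| ≤ K) ∧ Ex m r ∧
      ∀ ω, ∀ y ∈ S ω, g ω y = a ω + y * r ω y

variable {S}

lemma Bd.add {g h : Ω → ℝ → ℝ} (hg : Bd S g) (hh : Bd S h) :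
    Bd S (fun ω y => g ω y + h ω y) := by
  obtain ⟨K, hK⟩ := hg; obtain ⟨L, hL⟩ := hh
  exact ⟨K + L, fun ω y hy => (abs_add_le _ _).trans (add_le_add (hK ω y hy) (hL ω y hy))⟩

lemma Bd.mul {g h : Ω → ℝ → ℝ} (hg : Bd S g) (hh : Bd S h) :
    Bd S (fun ω y => g ω y * h ω y) := by
  obtain ⟨K, hK⟩ := hg; obtain ⟨L, hL⟩ := hh
  refine ⟨K * L, fun ω y hy => ?_⟩
  rw [abs_mul]
  exact mul_le_mul (hK ω y hy) (hL ω y hy) (abs_nonneg _) ((abs_nonneg _).trans (hK ω y hy))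

lemma Bd.pow {g : Ω → ℝ → ℝ} (hg : Bd S g) (k : ℕ) : Bd S (fun ω y => g ω y ^ k) := by
  induction k with
  | zero => exact ⟨1, fun ω y hy => by simp⟩
  | succ k ih => simpa [pow_succ] using ih.mul hg

lemma Ex.congr {m : ℕ} {g h : Ω → ℝ → ℝ} (hg : Ex S m g)
    (e : ∀ ω, ∀ y ∈ S ω, h ω y = g ω y) : Ex S m h := by
  cases m with
  | zero => obtain ⟨K, hK⟩ := hg; exact ⟨K, fun ω y hy => by rw [e ω y hy]; exact hK ω y hy⟩
  | succ m =>
    obtain ⟨a, r, ha, hr, h1⟩ := hg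
    exact ⟨a, r, ha, hr, fun ω y hy => by rw [e ω y hy]; exact h1 ω y hy⟩

lemma Ex.const (m : ℕ) {a : Ω → ℝ} (ha : ∃ K : ℝ, ∀ ω, |a ω| ≤ K) :
    Ex S m (fun ω _ => a ω) := by
  induction m generalizing a with
  | zero => obtain ⟨K, hK⟩ := ha; exact ⟨K, fun ω y _ => hK ω⟩
  | succ m ih => exact ⟨a, fun _ _ => 0, ha, ih (a := fun _ => 0) ⟨0, by simp⟩, by simp⟩

lemma Ex.add {m : ℕ} {g h : Ω → ℝ → ℝ} (hg : Ex S m g) (hh : Ex S m h) :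
    Ex S m (fun ω y => g ω y + h ω y) := by
  induction m generalizing g h with
  | zero => exact Bd.add hg hh
  | succ m ih =>
    obtain ⟨a, r, ⟨K, hK⟩, hr, h1⟩ := hg
    obtain ⟨b, q, ⟨L, hL⟩, hq, h2⟩ := hh
    refine ⟨fun ω => a ω + b ω, _, ⟨K + L, fun ω => (abs_add_le _ _).trans
      (add_le_add (hK ω) (hL ω))⟩, ih hr hq, fun ω y hy => ?_⟩
    simp only [h1 ω y hy, h2 ω y hy]; ring

variable (S) in
/-- the domains are uniformly bounded -/
def Dom : Prop := ∃ K : ℝ, ∀ ω, ∀ y ∈ S ω, |y| ≤ K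

lemma Ex.pred (hS : Dom S) {m : ℕ} {g : Ω → ℝ → ℝ} (hg : Ex S (m + 1) g) : Ex S m g := by
  induction m generalizing g with
  | zero =>
    obtain ⟨a, r, ⟨K, hK⟩, hr, h1⟩ := hg
    have : Bd S (fun ω y => a ω + y * r ω y) :=
      Bd.add ⟨K, fun ω y _ => hK ω⟩ (Bd.mul hS hr)
    exact Ex.congr (m := 0) this h1
  | succ m ih =>
    obtain ⟨a, r, hK, hr, h1⟩ := hg
    exact ⟨a, r, hK, ih hr, h1⟩

lemma Ex.mono (hS : Dom S) {m k : ℕ} (hk : m ≤ k) {g : Ω → ℝ → ℝ} (hg : Ex S k g) :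
    Ex S m g := by
  induction k, hk using Nat.le_induction with
  | base => exact hg
  | succ k _ ih => exact ih (hg.pred hS)

lemma Ex.ymul {m : ℕ} {g : Ω → ℝ → ℝ} (hg : Ex S m g) : Ex S (m + 1) (fun ω y => y * g ω y) :=
  ⟨fun _ => 0, g, ⟨0, by simp⟩, hg, by simp⟩

lemma Ex.ypow {g : Ω → ℝ → ℝ} (hg : Bd S g) (m : ℕ) : Ex S m (fun ω y => y ^ m * g ω y) := by
  induction m with
  | zero => simpa using (show Ex S 0 g from hg)
  | succ m ih => exact ih.ymul.congr fun ω y _ => by ring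

lemma Ex.mul (hS : Dom S) {m : ℕ} {g h : Ω → ℝ → ℝ} (hg : Ex S m g) (hh : Ex S m h) :
    Ex S m (fun ω y => g ω y * h ω y) := by
  induction m generalizing g h with
  | zero => exact Bd.mul hg hh
  | succ m ih =>
    have hh' := hh.pred hS
    obtain ⟨a, r, ⟨K, hK⟩, hr, h1⟩ := hg
    obtain ⟨b, q, ⟨L, hL⟩, hq, h2⟩ := hh
    refine ⟨fun ω => a ω * b ω, _, ⟨K * L, fun ω => ?_⟩,
      (ih (Ex.const m ⟨K, hK⟩) hq).add (ih hr hh'), fun ω y hy => ?_⟩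
    · rw [abs_mul]
      exact mul_le_mul (hK ω) (hL ω) (abs_nonneg _) ((abs_nonneg _).trans (hK ω))
    · simp only [h1 ω y hy, h2 ω y hy]; ring

lemma Ex.pow (hS : Dom S) {m : ℕ} {g : Ω → ℝ → ℝ} (hg : Ex S m g) (k : ℕ) :
    Ex S m (fun ω y => g ω y ^ k) := by
  induction k with
  | zero => simpa using Ex.const (S := S) m (a := fun _ => 1) ⟨1, by simp⟩
  | succ k ih => simpa [pow_succ] using ih.mul hS hg

lemma Ex.sum {m : ℕ} {g : ℕ → Ω → ℝ → ℝ} (N : ℕ) (hg : ∀ k < N, Ex S m (g k)) :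
    Ex S m (fun ω y => ∑ k ∈ Finset.range N, g k ω y) := by
  induction N with
  | zero => simpa using Ex.const (S := S) m (a := fun _ => 0) ⟨0, by simp⟩
  | succ N ih =>
    simp only [Finset.sum_range_succ]
    exact (ih fun k hk => hg k (by omega)).add (hg N (by omega))

lemma Ex.comp (hS : Dom S) {m N : ℕ} (hm : m ≤ N) {U w g : Ω → ℝ → ℝ} {a : ℕ → Ω → ℝ} {K : ℝ}
    (ha : ∀ k < N, ∃ L : ℝ, ∀ ω, |a k ω| ≤ L) (hU : Ex S m U) (hw : Bd S w)
    (hUw : ∀ ω, ∀ y ∈ S ω, U ω y = y * w ω y)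
    (hg : ∀ ω, ∀ y ∈ S ω, |g ω y - ∑ k ∈ Finset.range N, a k ω * U ω y ^ k| ≤ K * |U ω y| ^ N) :
    Ex S m g := by
  have h1 : Ex S m (fun ω y => ∑ k ∈ Finset.range N, a k ω * U ω y ^ k) :=
    Ex.sum N fun k hk => (Ex.const m (ha k hk)).mul hS (hU.pow hS k)
  set R : Ω → ℝ → ℝ := fun ω y =>
    (g ω y - ∑ k ∈ Finset.range N, a k ω * U ω y ^ k) / U ω y ^ N with hR
  have hRb : Bd S R := by
    refine ⟨|K|, fun ω y hy => ?_⟩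
    simp only [hR, abs_div, abs_pow]
    refine div_le_of_le_mul₀ (by positivity) (by positivity) ((hg ω y hy).trans ?_)
    gcongr; exact le_abs_self K
  have h2 := (Ex.ypow ((hw.pow N).mul hRb) N).mono hS hm
  refine (h1.add h2).congr fun ω y hy => ?_
  have h3 := hg ω y hy
  have : y ^ N * (w ω y ^ N * R ω y) = U ω y ^ N * R ω y := by rw [hUw ω y hy]; ring
  rw [this]
  simp only [hR]
  by_cases h0 : U ω y ^ N = 0
  · have h4 : |U ω y| ^ N = 0 := by rw [← abs_pow, h0, abs_zero]
    rw [h4, mul_zero] at h3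
    have := abs_nonpos_iff.mp h3
    rw [h0]; linarith
  · field_simp; ring

lemma Ex.smooth (hS : Dom S) {m : ℕ} {g r : Ω → ℝ → ℝ} (hg : Ex S m g) (hr : Bd S r)
    (hgr : ∀ ω, ∀ y ∈ S ω, g ω y = 1 + y * r ω y) {c : ℝ} (hc : 0 < c)
    (hgc : ∀ ω, ∀ y ∈ S ω, c ≤ g ω y) {φ : ℝ → ℝ}
    (hφ : ∀ x, 0 < x → ContDiffAt ℝ m φ x) : Ex S m (fun ω y => φ (g ω y)) := by
  obtain ⟨B, hB⟩ : Bd S g := hg.mono hS (Nat.zero_le m)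
  have hlo : 0 < min c (1 / 2) := lt_min hc (by norm_num)
  obtain ⟨b, K, hK⟩ := smooth_expand (a := min c (1 / 2)) (b := max B 2) (N := m) (f := φ)
    ((min_le_right _ _).trans_lt (by norm_num)) (lt_of_lt_of_le (by norm_num) (le_max_right _ _))
    (fun x hx => (hφ x (hlo.trans_le hx.1)).contDiffWithinAt)
  have hU : Ex S m (fun ω y => g ω y - 1) :=
    (hg.add (Ex.const m (a := fun _ => -1) ⟨1, by simp⟩)).congr fun ω y _ => by ring
  refine Ex.comp hS (N := m) le_rfl (U := fun ω y => g ω y - 1) (w := r) (a := fun k _ => b k)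
    (K := K) (fun k _ => ⟨|b k|, fun _ => le_rfl⟩) hU hr
    (fun ω y hy => by rw [hgr ω y hy]; ring) (fun ω y hy => hK _ ⟨?_, ?_⟩)
  · exact (min_le_left _ _).trans (hgc ω y hy)
  · exact (le_abs_self _).trans ((hB ω y hy).trans (le_max_left _ _))

lemma Ex.coeffs {m : ℕ} {g : Ω → ℝ → ℝ} (hg : Ex S m g) :
    ∃ (p : ℕ → Ω → ℝ) (K : ℝ), ∀ ω, (∀ k < m, |p k ω| ≤ K) ∧
      ∀ y ∈ S ω, |g ω y - ∑ k ∈ Finset.range m, p k ω * y ^ k| ≤ K * |y| ^ m := by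
  induction m generalizing g with
  | zero => obtain ⟨K, hK⟩ := hg; exact ⟨fun _ _ => 0, K, fun ω => ⟨by simp, by simpa using hK ω⟩⟩
  | succ m ih =>
    obtain ⟨a, r, ⟨L, hL⟩, hr, h1⟩ := hg
    obtain ⟨p, K, hp⟩ := ih hr
    refine ⟨fun k ω => if k = 0 then a ω else p (k - 1) ω, max L K, fun ω => ⟨?_, ?_⟩⟩
    · intro k hk
      rcases k with _ | k
      · simpa using Or.inl (hL ω)
      · simpa using Or.inr ((hp ω).1 k (by omega))
    · intro y hy
      rw [Finset.sum_range_succ', h1 ω y hy]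
      simp only [Nat.add_eq_zero_iff, one_ne_zero, and_false, if_false, if_true, pow_zero, mul_one,
        Nat.add_sub_cancel]
      have : a ω + y * r ω y - (∑ k ∈ Finset.range m, p k ω * y ^ (k + 1) + a ω)
          = y * (r ω y - ∑ k ∈ Finset.range m, p k ω * y ^ k) := by
        rw [mul_sub, Finset.mul_sum]
        have : ∀ k ∈ Finset.range m, y * (p k ω * y ^ k) = p k ω * y ^ (k + 1) :=
          fun k _ => by ring
        rw [Finset.sum_congr rfl this]; ring
      rw [this, abs_mul, pow_succ]
      calc |y| * _ ≤ |y| * (K * |y| ^ m) := by gcongr; exact (hp ω).2 y hy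
        _ = K * (|y| ^ m * |y|) := by ring
        _ ≤ _ := by gcongr; exact le_max_right _ _

lemma exists_lin {g U w : Ω → ℝ → ℝ} {K : ℝ} (hw : Bd S w)
    (hUw : ∀ ω, ∀ y ∈ S ω, U ω y = y * w ω y)
    (h : ∀ ω, ∀ y ∈ S ω, |g ω y - 1| ≤ K * |U ω y|) :
    ∃ r, Bd S r ∧ ∀ ω, ∀ y ∈ S ω, g ω y = 1 + y * r ω y := by
  obtain ⟨W, hW⟩ := hw
  refine ⟨fun ω y => (g ω y - 1) / y, ⟨|K| * W, fun ω y hy => ?_⟩, fun ω y hy => ?_⟩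
  · have hW' := hW ω y hy
    have hW0 : 0 ≤ W := (abs_nonneg _).trans hW'
    simp only [abs_div]
    refine div_le_of_le_mul₀ (by positivity) (by positivity) ((h ω y hy).trans ?_)
    rw [hUw ω y hy, abs_mul]
    calc K * (|y| * |w ω y|) ≤ |K| * (|y| * W) := by gcongr; exact le_abs_self K
      _ = _ := by ring
  · have h1 := h ω y hy
    by_cases h0 : y = 0
    · rw [hUw ω y hy, h0] at h1
      simp only [zero_mul, abs_zero, mul_zero] at h1
      have := abs_nonpos_iff.mp h1
      rw [h0]; linarith
    · field_simp; ring

end E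

lemma div_expand {N j : ℕ} {q : ℕ → ℝ} {P B D u : ℝ} (hu : u ≠ 0) (hD : 0 < D)
    (h : |P - ∑ k ∈ Finset.range N, q k * u ^ (k + j)| ≤ B * |u| ^ (N + j)) :
    |P / (D * u ^ j) - ∑ k ∈ Finset.range N, q k / D * u ^ k| ≤ B / D * |u| ^ N := by
  have e : P / (D * u ^ j) - ∑ k ∈ Finset.range N, q k / D * u ^ k
      = (P - ∑ k ∈ Finset.range N, q k * u ^ (k + j)) / (D * u ^ j) := by
    rw [sub_div, Finset.sum_div]
    congr 1
    refine Finset.sum_congr rfl fun k _ => ?_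
    rw [pow_add]; field_simp
  have hu' : 0 < |u| := abs_pos.mpr hu
  rw [e, abs_div, abs_mul, abs_of_pos hD, abs_pow, div_le_iff₀ (by positivity)]
  refine h.trans (le_of_eq ?_)
  rw [pow_add]; field_simp

section conv
variable {α β γ c0 : ℝ} {F0 F1 F2 : ℝ → ℝ}

lemma conv1 (h1 : ∀ x ∈ Icc α β, HasDerivWithinAt F1 (F2 x) (Icc α β) x)
    (h2 : ∀ x ∈ Icc α β, c0 ≤ F2 x) {x y : ℝ} (hx : x ∈ Icc α β) (hy : y ∈ Icc α β)
    (hxy : x ≤ y) : c0 * (y - x) ≤ F1 y - F1 x := by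
  have : MonotoneOn (fun x => F1 x - c0 * x) (Icc α β) := by
    refine monotoneOn_of_hasDerivWithinAt_nonneg (f' := fun x => F2 x - c0) (convex_Icc _ _)
      ?_ ?_ ?_
    · exact ContinuousOn.sub (fun x hx => (h1 x hx).continuousWithinAt) (by fun_prop)
    · intro x hx
      have hx' := interior_subset hx
      have h3 := ((h1 x hx').mono interior_subset).sub
        ((hasDerivAt_id x).const_mul c0).hasDerivWithinAt
      exact h3.congr_deriv (by simp)
    · intro x hx; linarith [h2 x (interior_subset hx)]
  have := this hx hy hxy
  simp only at this
  linarith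

lemma conv2 (hαγ : α ≤ γ) (hγβ : γ ≤ β)
    (h0 : ∀ x ∈ Icc α β, HasDerivWithinAt F0 (F1 x) (Icc α β) x)
    (h1 : ∀ x ∈ Icc α β, HasDerivWithinAt F1 (F2 x) (Icc α β) x)
    (h2 : ∀ x ∈ Icc α β, c0 ≤ F2 x) (hγ : F1 γ = 0) :
    MonotoneOn (fun x => F0 x - c0 / 2 * (x - γ) ^ 2) (Icc γ β) ∧
    AntitoneOn (fun x => F0 x - c0 / 2 * (x - γ) ^ 2) (Icc α γ) := by
  have hγs : γ ∈ Icc α β := ⟨hαγ, hγβ⟩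
  have hc : ContinuousOn (fun x => F0 x - c0 / 2 * (x - γ) ^ 2) (Icc α β) :=
    ContinuousOn.sub (fun x hx => (h0 x hx).continuousWithinAt) (by fun_prop)
  have hd : ∀ x ∈ Icc α β, HasDerivWithinAt (fun x => F0 x - c0 / 2 * (x - γ) ^ 2)
      (F1 x - c0 * (x - γ)) (Icc α β) x := by
    intro x hx
    have h3 := (h0 x hx).sub
        ((((hasDerivAt_id x).sub_const γ).pow 2).const_mul (c0 / 2)).hasDerivWithinAt
    refine (h3.congr_deriv ?_)
    simp; ring
  have s1 : Icc γ β ⊆ Icc α β := Icc_subset_Icc_left hαγ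
  have s2 : Icc α γ ⊆ Icc α β := Icc_subset_Icc_right hγβ
  constructor
  · refine monotoneOn_of_hasDerivWithinAt_nonneg (convex_Icc _ _) (hc.mono s1)
      (fun x hx => (hd x (s1 (interior_subset hx))).mono (interior_subset.trans s1))
      (fun x hx => ?_)
    have hx' := interior_subset hx
    have := conv1 h1 h2 hγs (s1 hx') hx'.1
    linarith
  · refine antitoneOn_of_hasDerivWithinAt_nonpos (convex_Icc _ _) (hc.mono s2)
      (fun x hx => (hd x (s2 (interior_subset hx))).mono (interior_subset.trans s2))
      (fun x hx => ?_)
    have hx' := interior_subset hx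
    have := conv1 h1 h2 (s2 hx') hγs hx'.2
    linarith

lemma conv3 (hαγ : α ≤ γ) (hγβ : γ ≤ β)
    (h0 : ∀ x ∈ Icc α β, HasDerivWithinAt F0 (F1 x) (Icc α β) x)
    (h1 : ∀ x ∈ Icc α β, HasDerivWithinAt F1 (F2 x) (Icc α β) x)
    (h2 : ∀ x ∈ Icc α β, c0 ≤ F2 x) (hγ : F1 γ = 0) {x : ℝ} (hx : x ∈ Icc α β) :
    c0 / 2 * (x - γ) ^ 2 ≤ F0 x - F0 γ := by
  obtain ⟨hm, ha⟩ := conv2 hαγ hγβ h0 h1 h2 hγ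
  rcases le_total γ x with h | h
  · have := hm ⟨le_rfl, hγβ⟩ ⟨h, hx.2⟩ h
    simp at this; linarith
  · have := ha ⟨hx.1, h⟩ ⟨hαγ, le_rfl⟩ h
    simp at this; linarith

lemma conv4 (hc : 0 ≤ c0) (hαγ : α ≤ γ) (hγβ : γ ≤ β)
    (h0 : ∀ x ∈ Icc α β, HasDerivWithinAt F0 (F1 x) (Icc α β) x)
    (h1 : ∀ x ∈ Icc α β, HasDerivWithinAt F1 (F2 x) (Icc α β) x)
    (h2 : ∀ x ∈ Icc α β, c0 ≤ F2 x) (hγ : F1 γ = 0) {x z : ℝ} (hx : x ∈ Icc α β)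
    (hz : z ∈ Icc α β) (hs : (γ < x ∧ γ < z) ∨ (x < γ ∧ z < γ)) :
    c0 / 2 * |x - γ| * |z - x| ≤ |F0 z - F0 x| := by
  obtain ⟨hm, ha⟩ := conv2 hαγ hγβ h0 h1 h2 hγ
  rcases hs with ⟨h, h'⟩ | ⟨h, h'⟩
  · rw [abs_of_pos (sub_pos.mpr h)]
    rcases le_total x z with h3 | h3
    · have := hm ⟨h.le, hx.2⟩ ⟨h'.le, hz.2⟩ h3
      simp only at this
      rw [abs_of_nonneg (sub_nonneg.mpr h3)]
      refine le_trans ?_ (le_abs_self _)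
      nlinarith [mul_nonneg hc (mul_nonneg (sub_nonneg.mpr h3) (sub_pos.mpr h').le)]
    · have := hm ⟨h'.le, hz.2⟩ ⟨h.le, hx.2⟩ h3
      simp only at this
      rw [abs_of_nonpos (sub_nonpos.mpr h3)]
      refine le_trans ?_ (neg_le_abs _)
      nlinarith [mul_nonneg hc (mul_nonneg (sub_nonneg.mpr h3) (sub_pos.mpr h').le)]
  · rw [abs_of_neg (sub_neg.mpr h)]
    rcases le_total x z with h3 | h3
    · have := ha ⟨hx.1, h.le⟩ ⟨hz.1, h'.le⟩ h3
      simp only at this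
      rw [abs_of_nonneg (sub_nonneg.mpr h3)]
      refine le_trans ?_ (neg_le_abs _)
      nlinarith [mul_nonneg hc (mul_nonneg (sub_nonneg.mpr h3) (sub_pos.mpr h').le)]
    · have := ha ⟨hz.1, h'.le⟩ ⟨hx.1, h.le⟩ h3
      simp only at this
      rw [abs_of_nonpos (sub_nonpos.mpr h3)]
      refine le_trans ?_ (le_abs_self _)
      nlinarith [mul_nonneg hc (mul_nonneg (sub_nonneg.mpr h3) (sub_pos.mpr h').le)]

lemma deriv_xof (hc : 0 < c0) (hαγ : α ≤ γ) (hγβ : γ ≤ β)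
    (h0 : ∀ x ∈ Icc α β, HasDerivWithinAt F0 (F1 x) (Icc α β) x)
    (h1 : ∀ x ∈ Icc α β, HasDerivWithinAt F1 (F2 x) (Icc α β) x)
    (h2 : ∀ x ∈ Icc α β, c0 ≤ F2 x) (hγ : F1 γ = 0) {L r1 r2 : ℝ} {xof : ℝ → ℝ}
    (hx : ∀ y ∈ Icc (-r1) r2, xof y ∈ Icc α β ∧ F0 (xof y) = F0 γ + L * y ^ 2 ∧
      (y < 0 → xof y < γ) ∧ (0 < y → γ < xof y)) {y : ℝ} (hy : y ∈ Icc (-r1) r2) (hy0 : y ≠ 0) :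
    HasDerivWithinAt xof (2 * L * y / F1 (xof y)) (Icc (-r1) r2) y := by
  obtain ⟨hxs, hxf, hxn, hxp⟩ := hx y hy
  have hγs : γ ∈ Icc α β := ⟨hαγ, hγβ⟩
  have hne : xof y ≠ γ := by
    rcases lt_or_gt_of_ne hy0 with h | h
    · exact (hxn h).ne
    · exact (hxp h).ne'
  have hF1 : F1 (xof y) ≠ 0 := by
    rcases lt_or_gt_of_ne hne with h | h
    · have := conv1 h1 h2 hxs hγs h.le
      have := mul_pos hc (sub_pos.mpr h)
      intro h; linarith
    · have := conv1 h1 h2 hγs hxs h.le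
      have := mul_pos hc (sub_pos.mpr h)
      intro h; linarith
  set D := c0 / 2 * |xof y - γ| with hD
  have hDpos : 0 < D := by
    have := abs_pos.mpr (sub_ne_zero.mpr hne); positivity
  have hev : ∀ᶠ z in 𝓝[Icc (-r1) r2] y, (0 < y ∧ 0 < z) ∨ (y < 0 ∧ z < 0) := by
    refine Filter.Eventually.filter_mono nhdsWithin_le_nhds ?_
    rcases lt_or_gt_of_ne hy0 with h | h
    · filter_upwards [Iio_mem_nhds h] with z hz; exact Or.inr ⟨h, hz⟩
    · filter_upwards [Ioi_mem_nhds h] with z hz; exact Or.inl ⟨h, hz⟩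
  have hcont : Tendsto xof (𝓝[Icc (-r1) r2] y) (𝓝 (xof y)) := by
    rw [tendsto_iff_dist_tendsto_zero]
    have hlim : Tendsto (fun z => |L * z ^ 2 - L * y ^ 2| / D) (𝓝[Icc (-r1) r2] y) (𝓝 0) := by
      have : Continuous (fun z => |L * z ^ 2 - L * y ^ 2| / D) := by fun_prop
      have := (this.tendsto y).mono_left (nhdsWithin_le_nhds (s := Icc (-r1) r2))
      simpa using this
    refine squeeze_zero' (Eventually.of_forall fun _ => dist_nonneg) ?_ hlim
    filter_upwards [hev, self_mem_nhdsWithin] with z hz hzs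
    obtain ⟨hzs, hzf, hzn, hzp⟩ := hx z hzs
    rw [Real.dist_eq, le_div_iff₀ hDpos, mul_comm]
    have h5 := conv4 hc.le hαγ hγβ h0 h1 h2 hγ hxs hzs (by
      rcases hz with ⟨a, b⟩ | ⟨a, b⟩
      · exact Or.inl ⟨hxp a, hzp b⟩
      · exact Or.inr ⟨hxn a, hzn b⟩)
    rw [hzf, hxf] at h5
    simpa using h5
  have hst : Tendsto xof (𝓝[Icc (-r1) r2] y) (𝓝[Icc α β] (xof y)) := by
    refine tendsto_nhdsWithin_of_tendsto_nhds_of_eventually_within _ hcont ?_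
    filter_upwards [self_mem_nhdsWithin] with z hz using (hx z hz).1
  have hh : HasDerivWithinAt (fun z => F0 γ + L * z ^ 2) (2 * L * y) (Icc (-r1) r2) y := by
    have := (((hasDerivAt_id y).pow 2).const_mul L).const_add (F0 γ)
    refine (this.congr_deriv ?_).hasDerivWithinAt
    simp; ring
  have := HasFDerivWithinAt.of_comp_of_leftInverse
    (f'symm := ContinuousLinearMap.toSpanSingleton ℝ (F1 (xof y))⁻¹) hst
    (h0 _ hxs).hasFDerivWithinAt hh.hasFDerivWithinAt ?_ ?_ hy
  · have := this.hasDerivWithinAt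
    refine this.congr_deriv ?_
    simp [div_eq_mul_inv]
  · filter_upwards [self_mem_nhdsWithin] with z hz using (hx z hz).2.1
  · intro t
    simp [hF1]

end conv

/-- The data of the problem. -/
structure Dat (n : ℕ) (C : ℕ → ℝ) where
  (α β γ M T r1 r2 : ℝ)
  (f xof : ℝ → ℝ)
  hαγ : α < γ
  hγβ : γ < β
  hM : 0 < M
  hT : 0 < T
  hf : ContDiffOn ℝ ((2 * n + 3 : ℕ) : WithTop ℕ∞) f (Icc α β)
  hf1 : derivWithin f (Icc α β) γ = 0
  hub : ∀ r, 2 ≤ r → r ≤ 2 * n + 3 → ∀ x ∈ Icc α β,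
    |iteratedDerivWithin r f (Icc α β) x| ≤ C r * T / M ^ r
  hlb : ∀ x ∈ Icc α β, T / (C 2 * M ^ 2) ≤ iteratedDerivWithin 2 f (Icc α β) x
  hr1 : 0 < r1
  hr2 : 0 < r2
  hx0 : xof 0 = γ
  hx : ∀ y ∈ Icc (-r1) r2, xof y ∈ Icc α β ∧
    f (xof y) = f γ + iteratedDerivWithin 2 f (Icc α β) γ / 2 * y ^ 2 ∧
    (y < 0 → xof y < γ) ∧ (0 < y → γ < xof y)

namespace Dat
variable {n : ℕ} {C : ℕ → ℝ}

/-- iterated derivatives -/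
noncomputable def F (d : Dat n C) (i : ℕ) : ℝ → ℝ := iteratedDerivWithin i d.f (Icc d.α d.β)
/-- the quadratic coefficient -/
noncomputable def L (d : Dat n C) : ℝ := d.F 2 d.γ / 2
/-- the lower bound for the second derivative -/
noncomputable def c0 (d : Dat n C) : ℝ := d.T / (C 2 * d.M ^ 2)
/-- the rescaled variable -/
noncomputable def U (d : Dat n C) (y : ℝ) : ℝ := (d.xof (d.M * y) - d.γ) / d.M
/-- ratio -/
noncomputable def w (d : Dat n C) (y : ℝ) : ℝ := if y = 0 then 1 else d.U y / y
/-- normalized `f` -/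
noncomputable def G (d : Dat n C) (y : ℝ) : ℝ := if y = 0 then 1 else y ^ 2 / d.U y ^ 2
/-- normalized derivative of the phase -/
noncomputable def A (d : Dat n C) (y : ℝ) : ℝ :=
  if y = 0 then 1 else d.F 1 (d.xof (d.M * y)) / (2 * d.L * d.M * d.U y)
/-- domain -/
def S (B : ℝ) (d : Dat n C) : Set ℝ := {y | d.M * y ∈ Icc (-d.r1) d.r2 ∧ |y| ≤ B}

lemma hs (d : Dat n C) : d.γ ∈ Icc d.α d.β := ⟨d.hαγ.le, d.hγβ.le⟩
lemma hab (d : Dat n C) : d.α < d.β := d.hαγ.trans d.hγβ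
lemma hF (d : Dat n C) (i : ℕ) (hi : i < 2 * n + 3) (x : ℝ) (hx : x ∈ Icc d.α d.β) :
    HasDerivWithinAt (d.F i) (d.F (i + 1) x) (Icc d.α d.β) x :=
  hasDeriv_iter d.hab d.hf hi hx
lemma F0 (d : Dat n C) : d.F 0 = d.f := by ext x; simp [F]
lemma F1 (d : Dat n C) : d.F 1 d.γ = 0 := by
  rw [F, iteratedDerivWithin_one]; exact d.hf1
lemma c0_pos (d : Dat n C) (hC : ∀ k, 0 < C k) : 0 < d.c0 := by
  have := d.hM; have := d.hT; have := hC 2; unfold c0; positivity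
lemma c0_le (d : Dat n C) : d.c0 ≤ 2 * d.L := by
  have := d.hlb _ d.hs
  unfold c0 L F; linarith
lemma L_pos (d : Dat n C) (hC : ∀ k, 0 < C k) : 0 < d.L := by
  linarith [d.c0_pos hC, d.c0_le]
lemma ratio (d : Dat n C) (hC : ∀ k, 0 < C k) : 1 / (C 2) ^ 2 ≤ d.c0 / (2 * d.L) := by
  have h1 := (le_abs_self _).trans (d.hub 2 le_rfl (by omega) _ d.hs)
  have h2 : 2 * d.L ≤ C 2 * d.T / d.M ^ 2 := by unfold L F; linarith
  have := d.L_pos hC; have := hC 2; have hM := d.hM; have := d.hT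
  rw [div_le_div_iff₀ (by positivity) (by positivity), c0]
  refine (by linarith : 1 * (2 * d.L) ≤ C 2 * d.T / d.M ^ 2).trans (le_of_eq ?_)
  field_simp
lemma ratio_le (d : Dat n C) (hC : ∀ k, 0 < C k) : d.c0 / (2 * d.L) ≤ 1 := by
  have := d.L_pos hC
  rw [div_le_one (by positivity)]; exact d.c0_le

lemma h0 (d : Dat n C) : ∀ x ∈ Icc d.α d.β,
    HasDerivWithinAt (d.F 0) (d.F 1 x) (Icc d.α d.β) x := d.hF 0 (by omega)
lemma h1 (d : Dat n C) : ∀ x ∈ Icc d.α d.β,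
    HasDerivWithinAt (d.F 1) (d.F 2 x) (Icc d.α d.β) x := d.hF 1 (by omega)
lemma h2 (d : Dat n C) : ∀ x ∈ Icc d.α d.β, d.c0 ≤ d.F 2 x := d.hlb

variable {B : ℝ}

lemma U_sign (d : Dat n C) {y : ℝ} (hy : y ∈ S B d) :
    (y < 0 → d.U y < 0) ∧ (0 < y → 0 < d.U y) := by
  have hM := d.hM
  obtain ⟨-, -, hn, hp⟩ := d.hx _ hy.1
  constructor
  · intro h
    exact div_neg_of_neg_of_pos (sub_neg.mpr (hn (mul_neg_of_pos_of_neg hM h))) hM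
  · intro h
    exact div_pos (sub_pos.mpr (hp (mul_pos hM h))) hM

lemma U_zero (d : Dat n C) : d.U 0 = 0 := by simp [U, d.hx0]
lemma U_ne (d : Dat n C) {y : ℝ} (hy : y ∈ S B d) (h0 : y ≠ 0) : d.U y ≠ 0 := by
  rcases lt_or_gt_of_ne h0 with h | h
  · exact ((d.U_sign hy).1 h).ne
  · exact ((d.U_sign hy).2 h).ne'
lemma w_pos (d : Dat n C) {y : ℝ} (hy : y ∈ S B d) : 0 < d.w y := by
  unfold w
  split_ifs with h0
  · norm_num
  · rcases lt_or_gt_of_ne h0 with h | h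
    · exact div_pos_of_neg_of_neg ((d.U_sign hy).1 h) h
    · exact div_pos ((d.U_sign hy).2 h) h
lemma U_eq (d : Dat n C) (y : ℝ) : d.U y = y * d.w y := by
  unfold w
  split_ifs with h0
  · simp [h0, U_zero]
  · field_simp
lemma wG (d : Dat n C) {y : ℝ} (hy : y ∈ S B d) : d.w y ^ 2 * d.G y = 1 := by
  unfold w G
  split_ifs with h0
  · norm_num
  · have := d.U_ne hy h0
    field_simp
lemma x_eq (d : Dat n C) (y : ℝ) : d.xof (d.M * y) - d.γ = d.M * d.U y := by
  have := d.hM.ne'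
  unfold U; field_simp
lemma f_eq (d : Dat n C) {y : ℝ} (hy : y ∈ S B d) :
    d.F 0 (d.xof (d.M * y)) - d.F 0 d.γ = d.L * d.M ^ 2 * y ^ 2 := by
  have := (d.hx _ hy.1).2.1
  rw [F0, this]; unfold L F; ring

lemma G_lb (d : Dat n C) (hC : ∀ k, 0 < C k) {y : ℝ} (hy : y ∈ S B d) :
    1 / (C 2) ^ 2 ≤ d.G y := by
  refine (d.ratio hC).trans ?_
  unfold G
  split_ifs with h0
  · exact d.ratio_le hC
  · have h3 := conv3 d.hαγ.le d.hγβ.le d.h0 d.h1 d.h2 d.F1 (d.hx _ hy.1).1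
    rw [d.f_eq hy, d.x_eq] at h3
    have := d.U_ne hy h0
    have hL := d.L_pos hC
    have hM := d.hM
    have hU2 : 0 < d.U y ^ 2 := by positivity
    rw [div_le_div_iff₀ (by positivity) hU2]
    have hM2 : 0 < d.M ^ 2 := by positivity
    refine le_of_mul_le_mul_left ?_ hM2
    nlinarith

lemma A_lb (d : Dat n C) (hC : ∀ k, 0 < C k) {y : ℝ} (hy : y ∈ S B d) :
    1 / (C 2) ^ 2 ≤ d.A y := by
  refine (d.ratio hC).trans ?_
  unfold A
  split_ifs with h0
  · exact d.ratio_le hC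
  · have hL := d.L_pos hC
    have hM := d.hM
    have hxs := (d.hx _ hy.1).1
    have hxe := d.x_eq y
    rcases lt_or_gt_of_ne (d.U_ne hy h0) with h | h
    · have hneg : d.M * d.U y < 0 := mul_neg_of_pos_of_neg hM h
      have h3 := conv1 d.h1 d.h2 hxs d.hs (by linarith)
      rw [d.F1] at h3
      have e : d.c0 / (2 * d.L) = (d.c0 * (-(d.M * d.U y))) / (2 * d.L * d.M * (-d.U y)) := by
        have := h.ne; field_simp
      have e2 : d.F 1 (d.xof (d.M * y)) / (2 * d.L * d.M * d.U y)
        = (-d.F 1 (d.xof (d.M * y))) / (2 * d.L * d.M * (-d.U y)) := by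
        rw [mul_neg, neg_div_neg_eq]
      rw [e, e2]
      have : 0 < -d.U y := by linarith
      refine div_le_div_of_nonneg_right ?_ (by positivity)
      rw [← hxe]; linarith
    · have hpos : 0 < d.M * d.U y := mul_pos hM h
      have h3 := conv1 d.h1 d.h2 d.hs hxs (by linarith)
      rw [d.F1] at h3
      have e : d.c0 / (2 * d.L) = (d.c0 * (d.M * d.U y)) / (2 * d.L * d.M * d.U y) := by
        have := h.ne'; field_simp
      rw [e]
      refine div_le_div_of_nonneg_right ?_ (by positivity)
      rw [← hxe]; linarith

/-- Taylor coefficients of `G` -/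
noncomputable def g (d : Dat n C) (k : ℕ) : ℝ :=
  d.F (k + 2) d.γ / ((k + 2).factorial : ℝ) * d.M ^ (k + 2) / (d.L * d.M ^ 2)
/-- Taylor coefficients of `A` -/
noncomputable def a (d : Dat n C) (k : ℕ) : ℝ :=
  d.F (k + 2) d.γ / ((k + 1).factorial : ℝ) * d.M ^ (k + 1) / (2 * d.L * d.M)

lemma key (d : Dat n C) (hC : ∀ k, 0 < C k) : d.T / (2 * d.L * d.M ^ 2) ≤ C 2 := by
  have hL := d.L_pos hC
  have hM := d.hM
  have h3 := d.c0_le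
  have h4 := hC 2
  unfold c0 at h3
  rw [div_le_iff₀ (by positivity)] at h3 ⊢
  linarith

lemma G_exp (d : Dat n C) (hC : ∀ k, 0 < C k) {N : ℕ} (hN : 1 ≤ N) (hN2 : N ≤ 2 * n + 1)
    {y : ℝ} (hy : y ∈ S B d) :
    |d.G y - ∑ k ∈ Finset.range N, d.g k * d.U y ^ k| ≤ 2 * C 2 * C (N + 2) * |d.U y| ^ N := by
  have hL := d.L_pos hC
  have hM := d.hM
  by_cases h0 : y = 0
  · obtain ⟨N, rfl⟩ := Nat.exists_eq_add_of_le' hN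
    rw [Finset.sum_range_succ', h0, U_zero]
    have : d.g 0 = 1 := by
      have : d.F 2 d.γ = 2 * d.L := by unfold L; ring
      simp only [g, zero_add, this, Nat.factorial]
      push_cast; field_simp
    simp [this, G]
  have hU := d.U_ne hy h0
  have ht := taylor_two_sided (convex_Icc _ _) d.hs (N + 2) d.F (C (N + 2) * d.T / d.M ^ (N + 2))
    (fun i hi => d.hF i (by omega)) (d.hub (N + 2) (by omega) (by omega)) _ (d.hx _ hy.1).1
  rw [Finset.sum_range_succ', Finset.sum_range_succ', d.x_eq] at ht
  simp only [zero_add, d.F1, zero_mul, add_zero, Nat.factorial, Nat.cast_one, div_one,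
    pow_zero, mul_one] at ht
  have ht2 : |d.L * d.M ^ 2 * y ^ 2 - ∑ k ∈ Finset.range N,
      (d.F (k + 2) d.γ / ((k + 2).factorial : ℝ) * d.M ^ (k + 2)) * d.U y ^ (k + 2)|
      ≤ C (N + 2) * d.T * |d.U y| ^ (N + 2) := by
    have e1 : ∀ S : ℝ, d.F 0 (d.xof (d.M * y)) - (S + d.F 0 d.γ) = d.L * d.M ^ 2 * y ^ 2 - S := by
      intro S; have := d.f_eq hy; linarith
    have e2 : C (N + 2) * d.T / d.M ^ (N + 2) * |d.M * d.U y| ^ (N + 2)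
        = C (N + 2) * d.T * |d.U y| ^ (N + 2) := by
      rw [abs_mul, abs_of_pos hM, mul_pow]; field_simp
    rw [e1, e2] at ht
    convert ht using 3
    refine Finset.sum_congr rfl fun k _ => ?_
    rw [mul_pow]
    simp only [Nat.factorial]
    ring
  have h5 := div_expand hU (show 0 < d.L * d.M ^ 2 by positivity) ht2
  have e : d.G y = d.L * d.M ^ 2 * y ^ 2 / (d.L * d.M ^ 2 * d.U y ^ 2) := by
    rw [G, if_neg h0]; field_simp
  rw [e]
  refine h5.trans ?_
  gcongr
  have hk := d.key hC
  have hCN := hC (N + 2)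
  calc C (N + 2) * d.T / (d.L * d.M ^ 2) = 2 * (d.T / (2 * d.L * d.M ^ 2)) * C (N + 2) := by
        field_simp
    _ ≤ _ := by gcongr

lemma A_exp (d : Dat n C) (hC : ∀ k, 0 < C k) {N : ℕ} (hN : 1 ≤ N) (hN2 : N ≤ 2 * n + 1)
    {y : ℝ} (hy : y ∈ S B d) :
    |d.A y - ∑ k ∈ Finset.range N, d.a k * d.U y ^ k| ≤ C 2 * C (N + 2) * |d.U y| ^ N := by
  have hL := d.L_pos hC
  have hM := d.hM
  by_cases h0 : y = 0
  · obtain ⟨N, rfl⟩ := Nat.exists_eq_add_of_le' hN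
    rw [Finset.sum_range_succ', h0, U_zero]
    have : d.a 0 = 1 := by
      have : d.F 2 d.γ = 2 * d.L := by unfold L; ring
      simp only [a, zero_add, this, Nat.factorial]
      push_cast; field_simp
    simp [this, A]
  have hU := d.U_ne hy h0
  have ht := taylor_two_sided (convex_Icc _ _) d.hs (N + 1) (fun i => d.F (i + 1))
    (C (N + 2) * d.T / d.M ^ (N + 2))
    (fun i hi => d.hF (i + 1) (by omega)) (d.hub (N + 2) (by omega) (by omega)) _ (d.hx _ hy.1).1
  rw [Finset.sum_range_succ', d.x_eq] at ht
  simp only [zero_add, d.F1, zero_div, zero_mul, add_zero] at ht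
  have ht2 : |d.F 1 (d.xof (d.M * y)) - ∑ k ∈ Finset.range N,
      (d.F (k + 2) d.γ / ((k + 1).factorial : ℝ) * d.M ^ (k + 1)) * d.U y ^ (k + 1)|
      ≤ C (N + 2) * d.T / d.M * |d.U y| ^ (N + 1) := by
    have e2 : C (N + 2) * d.T / d.M ^ (N + 2) * |d.M * d.U y| ^ (N + 1)
        = C (N + 2) * d.T / d.M * |d.U y| ^ (N + 1) := by
      rw [abs_mul, abs_of_pos hM, mul_pow]; field_simp
      ring
    rw [e2] at ht
    convert ht using 3
    refine Finset.sum_congr rfl fun k _ => ?_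
    rw [mul_pow]
    ring
  have h5 := div_expand hU (show 0 < 2 * d.L * d.M by positivity) ht2
  have e : d.A y = d.F 1 (d.xof (d.M * y)) / (2 * d.L * d.M * d.U y ^ 1) := by
    rw [A, if_neg h0, pow_one]
  rw [e]
  refine h5.trans ?_
  gcongr
  have hk := d.key hC
  have hCN := hC (N + 2)
  calc C (N + 2) * d.T / d.M / (2 * d.L * d.M) = (d.T / (2 * d.L * d.M ^ 2)) * C (N + 2) := by
        field_simp
    _ ≤ _ := by gcongr

lemma g_zero (d : Dat n C) (hC : ∀ k, 0 < C k) : d.g 0 = 1 := by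
  have hL := d.L_pos hC
  have hM := d.hM
  have : d.F 2 d.γ = 2 * d.L := by unfold L; ring
  simp only [g, zero_add, this, Nat.factorial]
  push_cast; field_simp

lemma a_zero (d : Dat n C) (hC : ∀ k, 0 < C k) : d.a 0 = 1 := by
  have hL := d.L_pos hC
  have hM := d.hM
  have : d.F 2 d.γ = 2 * d.L := by unfold L; ring
  simp only [a, zero_add, this, Nat.factorial]
  push_cast; field_simp

lemma coef_bd (d : Dat n C) (hC : ∀ k, 0 < C k) {k j i : ℕ} (hk : k < 2 * n + 1) :
    |d.F (k + 2) d.γ / (j.factorial : ℝ) * d.M ^ i| ≤ C (k + 2) * d.T / d.M ^ (k + 2) * d.M ^ i := by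
  have hM := d.hM
  rw [abs_mul, abs_div, abs_of_pos (pow_pos hM i), Nat.abs_cast]
  refine mul_le_mul_of_nonneg_right ?_ (pow_pos hM i).le
  refine (div_le_self (abs_nonneg _) ?_).trans (d.hub (k + 2) (by omega) (by omega) _ d.hs)
  exact_mod_cast Nat.one_le_iff_ne_zero.mpr (Nat.factorial_ne_zero j)

lemma g_bd (d : Dat n C) (hC : ∀ k, 0 < C k) {k : ℕ} (hk : k < 2 * n + 1) :
    |d.g k| ≤ 2 * C 2 * C (k + 2) := by
  have hL := d.L_pos hC
  have hM := d.hM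
  have hk2 := d.key hC
  have hCN := hC (k + 2)
  rw [g, abs_div, abs_of_pos (show 0 < d.L * d.M ^ 2 by positivity)]
  calc _ ≤ C (k + 2) * d.T / d.M ^ (k + 2) * d.M ^ (k + 2) / (d.L * d.M ^ 2) := by
        gcongr; exact d.coef_bd hC hk
    _ = 2 * (d.T / (2 * d.L * d.M ^ 2)) * C (k + 2) := by field_simp
    _ ≤ _ := by gcongr

lemma a_bd (d : Dat n C) (hC : ∀ k, 0 < C k) {k : ℕ} (hk : k < 2 * n + 1) :
    |d.a k| ≤ C 2 * C (k + 2) := by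
  have hL := d.L_pos hC
  have hM := d.hM
  have hk2 := d.key hC
  have hCN := hC (k + 2)
  rw [a, abs_div, abs_of_pos (show 0 < 2 * d.L * d.M by positivity)]
  calc _ ≤ C (k + 2) * d.T / d.M ^ (k + 2) * d.M ^ (k + 1) / (2 * d.L * d.M) := by
        gcongr; exact d.coef_bd hC hk
    _ = (d.T / (2 * d.L * d.M ^ 2)) * C (k + 2) := by field_simp; ring
    _ ≤ _ := by gcongr

lemma dom : Dom (S (n := n) (C := C) B) := ⟨B, fun _ _ hy => hy.2⟩

lemma zero_mem (hB : 0 ≤ B) (d : Dat n C) : (0 : ℝ) ∈ S B d := by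
  refine ⟨?_, by simpa using hB⟩
  rw [mul_zero]
  exact ⟨by linarith [d.hr1], d.hr2.le⟩

lemma w_eq (d : Dat n C) {y : ℝ} (hy : y ∈ S B d) : d.w y = (√(d.G y))⁻¹ := by
  have h1 := d.wG hy
  have hw := d.w_pos hy
  have hG : d.G y = ((d.w y)⁻¹) ^ 2 := by field_simp; linarith
  rw [hG, Real.sqrt_sq (by positivity), inv_inv]

lemma w_bd (hC : ∀ k, 0 < C k) : Bd (S (n := n) (C := C) B) w := by
  refine ⟨C 2, fun d y hy => ?_⟩
  have h1 := d.wG hy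
  have hw := d.w_pos hy
  have h2 := d.G_lb hC hy
  have hC2 := hC 2
  rw [abs_of_pos hw]
  refine le_of_sq_le_sq ?_ hC2.le
  rw [div_le_iff₀ (by positivity)] at h2
  nlinarith [sq_nonneg (d.w y), sq_nonneg (C 2)]

lemma G_lin (hC : ∀ k, 0 < C k) : ∃ r, Bd (S (n := n) (C := C) B) r ∧
    ∀ d, ∀ y ∈ S B d, G d y = 1 + y * r d y := by
  refine exists_lin (U := U) (w := w) (K := 2 * C 2 * C (1 + 2)) (w_bd hC)
    (fun d y _ => d.U_eq y) (fun d y hy => ?_)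
  have := d.G_exp hC (N := 1) le_rfl (by omega) hy
  simpa [d.g_zero hC] using this

lemma A_lin (hC : ∀ k, 0 < C k) : ∃ r, Bd (S (n := n) (C := C) B) r ∧
    ∀ d, ∀ y ∈ S B d, A d y = 1 + y * r d y := by
  refine exists_lin (U := U) (w := w) (K := C 2 * C (1 + 2)) (w_bd hC)
    (fun d y _ => d.U_eq y) (fun d y hy => ?_)
  have := d.A_exp hC (N := 1) le_rfl (by omega) hy
  simpa [d.a_zero hC] using this

lemma G_Ex (hC : ∀ k, 0 < C k) {m : ℕ} (hm : m ≤ 2 * n + 1)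
    (hU : Ex (S (n := n) (C := C) B) m U) : Ex (S (n := n) (C := C) B) m G :=
  Ex.comp dom hm (N := 2 * n + 1) (U := U) (w := w) (a := fun k d => d.g k)
    (fun k hk => ⟨_, fun d => d.g_bd hC hk⟩) hU (w_bd hC) (fun d y _ => d.U_eq y)
    (fun d y hy => d.G_exp hC (by omega) le_rfl hy)

lemma A_Ex (hC : ∀ k, 0 < C k) {m : ℕ} (hm : m ≤ 2 * n + 1)
    (hU : Ex (S (n := n) (C := C) B) m U) : Ex (S (n := n) (C := C) B) m A :=
  Ex.comp dom hm (N := 2 * n + 1) (U := U) (w := w) (a := fun k d => d.a k)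
    (fun k hk => ⟨_, fun d => d.a_bd hC hk⟩) hU (w_bd hC) (fun d y _ => d.U_eq y)
    (fun d y hy => d.A_exp hC (by omega) le_rfl hy)

lemma w_Ex (hC : ∀ k, 0 < C k) {m : ℕ} (hm : m ≤ 2 * n + 1) :
    Ex (S (n := n) (C := C) B) m w := by
  induction m with
  | zero => exact w_bd hC
  | succ m ih =>
    have hU : Ex (S (n := n) (C := C) B) (m + 1) U :=
      (ih (by omega)).ymul.congr fun d y _ => d.U_eq y
    have hG := G_Ex hC hm hU
    obtain ⟨r, hr, hGr⟩ := G_lin (n := n) (B := B) hC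
    have hC2 := hC 2
    refine (hG.smooth dom hr hGr (c := 1 / (C 2) ^ 2) (by positivity)
      (fun d y hy => d.G_lb hC hy) (φ := fun t => (√t)⁻¹) (fun x hx => ?_)).congr
      fun d y hy => d.w_eq hy
    exact (Real.contDiffAt_sqrt hx.ne').inv (Real.sqrt_ne_zero'.mpr hx)

/-- the derivative -/
noncomputable def v (d : Dat n C) (y : ℝ) : ℝ :=
  derivWithin d.xof (Icc (-d.r1) d.r2) (d.M * y)

lemma ud (d : Dat n C) : UniqueDiffOn ℝ (Icc (-d.r1) d.r2) :=
  uniqueDiffOn_Icc (by linarith [d.hr1, d.hr2])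

lemma v_zero (hC : ∀ k, 0 < C k) (d : Dat n C) : d.v 0 = 1 := by
  have hw : Ex (S (n := n) (C := C) 1) 1 w := w_Ex hC (by omega)
  obtain ⟨a, r, -, ⟨K, hK⟩, h1⟩ := hw
  have ha : a d = 1 := by
    have := h1 d 0 (zero_mem zero_le_one d)
    simpa [w] using this.symm
  have hM := d.hM
  have h0 : (0 : ℝ) ∈ Icc (-d.r1) d.r2 := ⟨by linarith [d.hr1], d.hr2.le⟩
  have hO : (fun y => d.xof y - y - d.γ) =O[𝓝[Icc (-d.r1) d.r2] 0] fun y => ‖y - 0‖ ^ 2 := by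
    refine Asymptotics.IsBigO.of_bound (K / d.M) ?_
    have hn : ∀ᶠ y in 𝓝[Icc (-d.r1) d.r2] (0 : ℝ), |y| < d.M := by
      refine Filter.Eventually.filter_mono nhdsWithin_le_nhds ?_
      have := (continuous_abs (G := ℝ)).tendsto 0
      rw [abs_zero] at this
      exact this.eventually (Iio_mem_nhds hM)
    filter_upwards [hn, self_mem_nhdsWithin] with y hyM hy
    have e : d.M * (y / d.M) = y := by field_simp
    have hyS : y / d.M ∈ S 1 d := by
      refine ⟨by rw [e]; exact hy, ?_⟩
      rw [abs_div, abs_of_pos hM, div_le_one hM]; exact hyM.le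
    have h2 := d.x_eq (y / d.M)
    rw [e, d.U_eq, h1 d _ hyS, ha] at h2
    have h3 : d.xof y - y - d.γ = y ^ 2 / d.M * r d (y / d.M) := by
      have : d.xof y - y - d.γ = (d.xof y - d.γ) - y := by ring
      rw [this, h2]; field_simp; ring
    rw [h3, sub_zero, Real.norm_eq_abs, abs_mul, abs_div, abs_of_pos hM, abs_pow]
    have := hK d _ hyS
    simp only [norm_pow, Real.norm_eq_abs, abs_abs]
    calc |y| ^ 2 / d.M * |r d (y / d.M)| ≤ |y| ^ 2 / d.M * K := by gcongr
      _ = _ := by ring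
  have hd := (hO.hasFDerivWithinAt h0 (by norm_num)).hasDerivWithinAt
  have hd2 := (hd.add (hasDerivAt_id (0 : ℝ)).hasDerivWithinAt).add_const d.γ
  have hd3 : HasDerivWithinAt d.xof 1 (Icc (-d.r1) d.r2) 0 := by
    refine (hd2.congr_deriv (by simp)).congr_of_mem (fun y _ => ?_) h0
    simp only [Pi.add_apply, id_eq]
    ring
  rw [v, mul_zero]
  exact hd3.derivWithin (d.ud _ h0)

lemma v_eq (hC : ∀ k, 0 < C k) (d : Dat n C) {y : ℝ} (hy : y ∈ S B d) :
    d.v y = d.w y * d.G y * (d.A y)⁻¹ := by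
  by_cases h0 : y = 0
  · rw [h0, d.v_zero hC]; simp [w, G, A]
  have hM := d.hM
  have hL := d.L_pos hC
  have hU := d.U_ne hy h0
  have hd := deriv_xof (d.c0_pos hC) d.hαγ.le d.hγβ.le d.h0 d.h1 d.h2 d.F1 (L := d.L)
    (r1 := d.r1) (r2 := d.r2) (xof := d.xof) (by rw [d.F0]; exact d.hx) hy.1
    (mul_ne_zero hM.ne' h0)
  rw [v, hd.derivWithin (d.ud _ hy.1)]
  simp only [w, G, A, if_neg h0, inv_div]
  field_simp

theorem v_Ex (hC : ∀ k, 0 < C k) : Ex (S (n := n) (C := C) B) (2 * n + 1) v := by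
  have hw := w_Ex (n := n) (B := B) hC le_rfl
  have hU : Ex (S (n := n) (C := C) B) (2 * n + 1) U :=
    (hw.ymul.pred dom).congr fun d y _ => d.U_eq y
  have hG := G_Ex hC le_rfl hU
  have hA := A_Ex hC le_rfl hU
  obtain ⟨r, hr, hAr⟩ := A_lin (n := n) (B := B) hC
  have hC2 := hC 2
  have hA' := hA.smooth dom hr hAr (c := 1 / (C 2) ^ 2) (by positivity)
      (fun d y hy => d.A_lb hC hy) (φ := fun t => t⁻¹) (fun x hx => contDiffAt_inv ℝ hx.ne')
  exact ((hw.mul dom hG).mul dom hA').congr fun d y hy => d.v_eq hC hy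

end Dat
end WSP



/-- Lemma 2.2 of the paper: under the phase setup, with `x(y)` the inverse of
the change of variable `λ₂y² = f(x) − f(γ)`, there are coefficients `ρ₀ = 1`,
`|ρ_k| ≤ C/M^k` (`1 ≤ k ≤ 2n`) such that for `|y| ≤ min(r₁, r₂, ΔM)`,
`dx/dy = Σ_{k=0}^{2n} ρ_k y^k + O(|y|^{2n+1}/M^{2n+1})`, with `C` and the implied constant
depending only on `n` and `C₂,…,C_{2n+3}`. -/
theorem weighted_stationary_phase_stmt9
    (n : ℕ) (hn : 2 ≤ n) (C : ℕ → ℝ) (hC : ∀ k, 0 < C k) :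
    ∃ K : ℝ, 0 < K ∧
      ∀ (α β γ M T r1 r2 : ℝ) (f xof : ℝ → ℝ),
        α < γ → γ < β → 0 < M → 0 < T → β - α ≤ M →
        ContDiffOn ℝ (2 * n + 3) f (Set.Icc α β) →
        derivWithin f (Set.Icc α β) γ = 0 →
        (∀ r, 2 ≤ r → r ≤ 2 * n + 3 → ∀ x ∈ Set.Icc α β,
          |iteratedDerivWithin r f (Set.Icc α β) x| ≤ C r * T / M ^ r) →
        (∀ x ∈ Set.Icc α β,
          T / (C 2 * M ^ 2) ≤ iteratedDerivWithin 2 f (Set.Icc α β) x) →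
        let lam2 : ℝ := iteratedDerivWithin 2 f (Set.Icc α β) γ / 2
        let Δ : ℝ := min (Real.log 2 / C 2)
          (1 / ((C 2) ^ 2 *
            (Finset.Icc 2 (2 * n + 3)).sup' (Finset.nonempty_Icc.mpr (by omega)) C))
        0 < r1 → 0 < r2 →
        f α = f γ + lam2 * r1 ^ 2 →
        f β = f γ + lam2 * r2 ^ 2 →
        xof 0 = γ →
        (∀ y ∈ Set.Icc (-r1) r2, xof y ∈ Set.Icc α β ∧
          f (xof y) = f γ + lam2 * y ^ 2 ∧
          (y < 0 → xof y < γ) ∧ (0 < y → γ < xof y)) →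
        ∃ ρ : ℕ → ℝ,
          ρ 0 = 1 ∧
          (∀ k, 1 ≤ k → k ≤ 2 * n → |ρ k| ≤ K / M ^ k) ∧
          ∀ y : ℝ, |y| ≤ min r1 (min r2 (Δ * M)) →
            |derivWithin xof (Set.Icc (-r1) r2) y -
                ∑ k ∈ Finset.range (2 * n + 1), ρ k * y ^ k| ≤
              K * (|y| ^ (2 * n + 1) / M ^ (2 * n + 1)) := by
  obtain ⟨p, K, hp⟩ := (WSP.Dat.v_Ex (n := n) (C := C) (B := 1 + Real.log 2 / C 2) hC).coeffs
  refine ⟨|K| + 1, by positivity, ?_⟩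
  intro α β γ M T r1 r2 f xof hαγ hγβ hM hT _ hf hf1 hub hlb lam2 Δ hr1 hr2 _ _ hx0 hx
  have hf' : ContDiffOn ℝ ((2 * n + 3 : ℕ) : WithTop ℕ∞) f (Set.Icc α β) := by
    exact_mod_cast hf
  let d : WSP.Dat n C := ⟨α, β, γ, M, T, r1, r2, f, xof, hαγ, hγβ, hM, hT, hf', hf1, hub, hlb,
    hr1, hr2, hx0, hx⟩
  obtain ⟨h1, h2⟩ := hp d
  have hB : 0 ≤ 1 + Real.log 2 / C 2 := by
    have := hC 2
    have := Real.log_nonneg (x := 2) (by norm_num)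
    positivity
  have hp0 : p 0 d = 1 := by
    have := h2 0 (WSP.Dat.zero_mem hB d)
    rw [WSP.Dat.v_zero hC, Finset.sum_range_succ'] at this
    simp at this
    linarith
  refine ⟨fun k => p k d / M ^ k, by simp [hp0], fun k _ hk => ?_, fun y hy => ?_⟩
  · rw [abs_div, abs_of_pos (pow_pos hM k)]
    have := h1 k (by omega)
    have := le_abs_self K
    gcongr
    linarith
  · have hy1 : |y| ≤ r1 := hy.trans (min_le_left _ _)
    have hy2 : |y| ≤ r2 := hy.trans ((min_le_right _ _).trans (min_le_left _ _))
    have hy3 : |y| ≤ Δ * M := hy.trans ((min_le_right _ _).trans (min_le_right _ _))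
    have hΔ : Δ ≤ Real.log 2 / C 2 := min_le_left _ _
    have e : M * (y / M) = y := by field_simp
    have hyS : y / M ∈ WSP.Dat.S (1 + Real.log 2 / C 2) d := by
      refine ⟨?_, ?_⟩
      · change M * (y / M) ∈ Set.Icc (-r1) r2
        rw [e]
        exact ⟨by linarith [neg_abs_le y], (le_abs_self y).trans hy2⟩
      · rw [abs_div, abs_of_pos hM, div_le_iff₀ hM]
        nlinarith
    have h3 := h2 _ hyS
    have ev : d.v (y / M) = derivWithin xof (Set.Icc (-r1) r2) y := by
      change derivWithin xof (Set.Icc (-r1) r2) (M * (y / M)) = _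
      rw [e]
    rw [ev, abs_div, abs_of_pos hM, div_pow] at h3
    have es : ∑ k ∈ Finset.range (2 * n + 1), p k d / M ^ k * y ^ k
        = ∑ k ∈ Finset.range (2 * n + 1), p k d * (y / M) ^ k :=
      Finset.sum_congr rfl fun k _ => by rw [div_pow]; ring
    rw [es]
    refine h3.trans ?_
    have := le_abs_self K
    gcongr
    linarith
end

section
/- Under the setup below, there exist real numbers η'_0, η'_1, …, η'_{2n}, depending only on n, the derivatives f^{(k)}(γ) for 2 ≤ k ≤ 2n+2 and the derivatives g^{(ℓ)}(γ) for 0 ≤ ℓ ≤ 2n, with η'_0 = g(γ), η'_1 = g'(γ), and |η'_k| ≤ C·U(1/N^k + 1/(N M^{k−1})) for 1 ≤ k ≤ 2n, such that for all y with |y| ≤ min(r_1, r_2, Δ M) one has g(x(y)) = Σ_{k=0}^{2n} η'_k y^k + O( U |y|^{2n+1} ( 1/(N M^{2n}) + 1/N^{2n+1} ) ), with C and the implied constant depending only on n and C_0, …, C_{2n+3}. -/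
lemma wsp_taylor {α β γ x : ℝ} {f : ℝ → ℝ} (hγ : γ ∈ Set.Icc α β) (hx : x ∈ Set.Icc α β)
    (hne : γ ≠ x) (m : ℕ) (hf : ContDiffOn ℝ ((m + 1 : ℕ) : WithTop ℕ∞) f (Set.Icc α β)) :
    ∃ ξ ∈ Set.Icc α β, f x - ∑ k ∈ Finset.range (m + 1),
        iteratedDerivWithin k f (Set.Icc α β) γ / (k.factorial : ℝ) * (x - γ) ^ k =
      iteratedDerivWithin (m + 1) f (Set.Icc α β) ξ * (x - γ) ^ (m + 1) /
        ((m + 1).factorial : ℝ) := by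
  have hsub : Set.uIcc γ x ⊆ Set.Icc α β := Set.uIcc_subset_Icc hγ hx
  have hu : UniqueDiffOn ℝ (Set.uIcc γ x) := uniqueDiffOn_uIcc hne
  have hαβ : α < β := by
    rcases lt_or_gt_of_ne hne with h | h <;> linarith [hγ.1, hγ.2, hx.1, hx.2]
  have hI : UniqueDiffOn ℝ (Set.Icc α β) := uniqueDiffOn_Icc hαβ
  have hfu := hf.mono hsub
  have key : ∀ k ≤ m + 1, ∀ z ∈ Set.uIcc γ x,
      iteratedDerivWithin k f (Set.uIcc γ x) z = iteratedDerivWithin k f (Set.Icc α β) z := by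
    intro k hk z hz
    simp only [iteratedDerivWithin]
    rw [iteratedFDerivWithin_subset hsub hu hI (hf.of_le (by exact_mod_cast hk)) hz]
  obtain ⟨ξ, h1, h2⟩ := taylor_mean_remainder_lagrange (n := m) hne
    (hfu.of_le (by exact_mod_cast Nat.le_succ m))
    ((hfu.differentiableOn_iteratedDerivWithin (by exact_mod_cast Nat.lt_succ_self m) hu).mono
      Set.Ioo_subset_Icc_self)
  have hξ : ξ ∈ Set.uIcc γ x := Set.Ioo_subset_Icc_self h1
  refine ⟨ξ, hsub hξ, ?_⟩
  rw [key _ le_rfl _ hξ] at h2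
  rw [← h2, taylor_within_apply]
  congr 1
  refine Finset.sum_congr rfl fun k hk => ?_
  rw [key k (by have := Finset.mem_range.1 hk; omega) _ Set.left_mem_uIcc]
  simp only [smul_eq_mul]
  ring

/-- uniform expansions, in families -/
def WspE {ι : Type*} (S : ι → Set ℝ) : ℕ → (ι → ℝ → ℝ) → Prop
  | 0, φ => ∃ K : ℝ, ∀ i, ∀ v ∈ S i, |φ i v| ≤ K
  | m + 1, φ => ∃ a : ι → ℝ, (∃ K : ℝ, ∀ i, |a i| ≤ K) ∧
      ∃ ψ : ι → ℝ → ℝ, WspE S m ψ ∧ ∀ i, ∀ v ∈ S i, φ i v = a i + v * ψ i v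

namespace WspE
variable {ι : Type*} {S : ι → Set ℝ}

lemma congr {m : ℕ} {φ ψ : ι → ℝ → ℝ} (h : WspE S m φ)
    (e : ∀ i, ∀ v ∈ S i, ψ i v = φ i v) : WspE S m ψ := by
  cases m with
  | zero => obtain ⟨K, hK⟩ := h; exact ⟨K, fun i v hv => by rw [e i v hv]; exact hK i v hv⟩
  | succ m =>
    obtain ⟨a, ha, χ, hχ, h⟩ := h
    exact ⟨a, ha, χ, hχ, fun i v hv => by rw [e i v hv]; exact h i v hv⟩

lemma add {m : ℕ} : ∀ {φ ψ : ι → ℝ → ℝ}, WspE S m φ → WspE S m ψ →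
    WspE S m (fun i v => φ i v + ψ i v) := by
  induction m with
  | zero =>
    rintro φ ψ ⟨K, hK⟩ ⟨L, hL⟩
    exact ⟨K + L, fun i v hv => (abs_add_le _ _).trans (add_le_add (hK i v hv) (hL i v hv))⟩
  | succ m ih =>
    rintro φ ψ ⟨a, ⟨K, hK⟩, φ', h1, h2⟩ ⟨b, ⟨L, hL⟩, ψ', h3, h4⟩
    refine ⟨fun i => a i + b i, ⟨K + L, fun i => (abs_add_le _ _).trans
      (add_le_add (hK i) (hL i))⟩, _, ih h1 h3, fun i v hv => ?_⟩
    beta_reduce; rw [h2 i v hv, h4 i v hv]; ring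

lemma cmul {m : ℕ} {c : ι → ℝ} (hc : ∃ K : ℝ, ∀ i, |c i| ≤ K) : ∀ {φ : ι → ℝ → ℝ}, WspE S m φ →
    WspE S m (fun i v => c i * φ i v) := by
  obtain ⟨L, hL⟩ := hc
  induction m with
  | zero =>
    rintro φ ⟨K, hK⟩
    exact ⟨L * K, fun i v hv => by
      rw [abs_mul]
      exact mul_le_mul (hL i) (hK i v hv) (abs_nonneg _) ((abs_nonneg _).trans (hL i))⟩
  | succ m ih =>
    rintro φ ⟨a, ⟨K, hK⟩, φ', h1, h2⟩
    refine ⟨fun i => c i * a i, ⟨L * K, fun i => by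
      rw [abs_mul]
      exact mul_le_mul (hL i) (hK i) (abs_nonneg _) ((abs_nonneg _).trans (hL i))⟩,
      _, ih h1, fun i v hv => ?_⟩
    beta_reduce; rw [h2 i v hv]; ring

lemma const {c : ι → ℝ} (hc : ∃ K : ℝ, ∀ i, |c i| ≤ K) (m : ℕ) :
    WspE S m (fun i _ => c i) := by
  have h0 : ∀ m, WspE S m (fun _ _ => (0 : ℝ)) := by
    intro m
    induction m with
    | zero => exact ⟨0, fun i v hv => by simp⟩
    | succ m ih => exact ⟨fun _ => 0, ⟨0, fun i => by simp⟩, _, ih, fun i v hv => by simp⟩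
  cases m with
  | zero => obtain ⟨K, hK⟩ := hc; exact ⟨K, fun i v _ => hK i⟩
  | succ m => exact ⟨c, hc, _, h0 m, fun i v hv => by simp⟩

lemma vmul {m : ℕ} {φ : ι → ℝ → ℝ} (h : WspE S m φ) : WspE S (m + 1) (fun i v => v * φ i v) :=
  ⟨fun _ => 0, ⟨0, fun i => by simp⟩, φ, h, fun i v hv => by simp⟩

lemma of_succ {B : ℝ} (hB : ∀ i, ∀ v ∈ S i, |v| ≤ B) {m : ℕ} :
    ∀ {φ : ι → ℝ → ℝ}, WspE S (m + 1) φ → WspE S m φ := by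
  induction m with
  | zero =>
    rintro φ ⟨a, ⟨K, hK⟩, ψ, ⟨L, hL⟩, h⟩
    refine ⟨K + B * L, fun i v hv => ?_⟩
    rw [h i v hv]
    refine (abs_add_le _ _).trans (add_le_add (hK i) ?_)
    rw [abs_mul]
    exact mul_le_mul (hB i v hv) (hL i v hv) (abs_nonneg _) ((abs_nonneg _).trans (hB i v hv))
  | succ m ih =>
    rintro φ ⟨a, ha, ψ, hψ, h⟩
    exact ⟨a, ha, ψ, ih hψ, h⟩

lemma of_le {B : ℝ} (hB : ∀ i, ∀ v ∈ S i, |v| ≤ B) {m k : ℕ} (hk : k ≤ m)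
    {φ : ι → ℝ → ℝ} (h : WspE S m φ) : WspE S k φ := by
  induction hk with
  | refl => exact h
  | step _ ih => exact ih (of_succ hB h)

lemma mul {B : ℝ} (hB : ∀ i, ∀ v ∈ S i, |v| ≤ B) {m : ℕ} :
    ∀ {φ ψ : ι → ℝ → ℝ}, WspE S m φ → WspE S m ψ → WspE S m (fun i v => φ i v * ψ i v) := by
  induction m with
  | zero =>
    rintro φ ψ ⟨K, hK⟩ ⟨L, hL⟩
    exact ⟨K * L, fun i v hv => by
      rw [abs_mul]
      exact mul_le_mul (hK i v hv) (hL i v hv) (abs_nonneg _) ((abs_nonneg _).trans (hK i v hv))⟩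
  | succ m ih =>
    rintro φ ψ ⟨a, ⟨K, hK⟩, φ', h1, h2⟩ ⟨b, ⟨L, hL⟩, ψ', h3, h4⟩
    refine ⟨fun i => a i * b i, ⟨K * L, fun i => by
      rw [abs_mul]
      exact mul_le_mul (hK i) (hL i) (abs_nonneg _) ((abs_nonneg _).trans (hK i))⟩,
      _, ((cmul ⟨K, hK⟩ h3).add (cmul ⟨L, hL⟩ h1)).add (of_succ hB (vmul (ih h1 h3))),
      fun i v hv => ?_⟩
    beta_reduce; rw [h2 i v hv, h4 i v hv]; ring

lemma pow {B : ℝ} (hB : ∀ i, ∀ v ∈ S i, |v| ≤ B) {m : ℕ} {φ : ι → ℝ → ℝ} (h : WspE S m φ)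
    (k : ℕ) : WspE S m (fun i v => φ i v ^ k) := by
  induction k with
  | zero => exact (const (c := fun _ => 1) ⟨1, fun i => by simp⟩ m).congr fun i v hv => by simp
  | succ k ih => exact (mul hB ih h).congr fun i v hv => by rw [pow_succ]

lemma sum {κ : Type*} {m : ℕ} {φ : κ → ι → ℝ → ℝ} (s : Finset κ) (h : ∀ k ∈ s, WspE S m (φ k)) :
    WspE S m (fun i v => ∑ k ∈ s, φ k i v) := by
  classical
  induction s using Finset.induction_on with
  | empty => exact (const (c := fun _ => 0) ⟨0, fun i => by simp⟩ m).congr fun i v hv => by simp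
  | insert k s hk ih =>
    exact ((h k (by simp)).add (ih fun j hj => h j (by simp [hj]))).congr
      fun i v hv => by rw [Finset.sum_insert hk]

lemma vpow {m : ℕ} {φ : ι → ℝ → ℝ} (h : WspE S m φ) (k : ℕ) :
    WspE S (m + k) (fun i v => v ^ k * φ i v) := by
  induction k with
  | zero => exact h.congr fun i v hv => by simp
  | succ k ih => exact (vmul ih).congr fun i v hv => by ring

lemma split {B : ℝ} (hB : ∀ i, ∀ v ∈ S i, |v| ≤ B) {j : ℕ} : ∀ {φ : ι → ℝ → ℝ}, WspE S j φ → ∃ P e : ι → ℝ → ℝ, (∀ m, WspE S m P) ∧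
    WspE S 0 e ∧ ∀ i, ∀ v ∈ S i, φ i v = P i v + v ^ j * e i v := by
  induction j with
  | zero =>
    intro φ h
    exact ⟨fun _ _ => 0, φ, fun m => const (c := fun _ => 0) ⟨0, fun i => by simp⟩ m, h,
      fun i v hv => by simp⟩
  | succ j ih =>
    rintro φ ⟨a, ⟨K, hK⟩, ψ, h1, h2⟩
    obtain ⟨P, e, hP, he, h⟩ := ih h1
    refine ⟨fun i v => a i + v * P i v, e, fun m => ?_, he, fun i v hv => ?_⟩
    · have : WspE S (m + 1) (fun i v => a i + v * P i v) :=
        ⟨a, ⟨K, hK⟩, P, hP m, fun i v hv => rfl⟩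
      exact of_succ hB this
    · rw [h2 i v hv, h i v hv]; ring

lemma coeffs {m : ℕ} : ∀ {φ : ι → ℝ → ℝ}, WspE S m φ → ∃ K : ℝ, 0 ≤ K ∧ ∀ i, ∃ a : ℕ → ℝ,
    (∀ k, |a k| ≤ K) ∧
      ∀ v ∈ S i, |φ i v - ∑ k ∈ Finset.range m, a k * v ^ k| ≤ K * |v| ^ m := by
  induction m with
  | zero =>
    rintro φ ⟨K, hK⟩
    refine ⟨max K 0, le_max_right _ _, fun i => ⟨fun _ => 0, fun k => by simp, fun v hv => ?_⟩⟩
    simpa using Or.inl (hK i v hv)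
  | succ m ih =>
    rintro φ ⟨a, ⟨K, hK⟩, ψ, h1, h2⟩
    obtain ⟨L, hL0, hL⟩ := ih h1
    refine ⟨max K L, le_max_of_le_right hL0, fun i => ?_⟩
    obtain ⟨b, hb, hb'⟩ := hL i
    refine ⟨fun k => Nat.casesOn k (a i) b, ?_, fun v hv => ?_⟩
    · rintro (_ | k)
      · exact (hK i).trans (le_max_left _ _)
      · exact (hb k).trans (le_max_right _ _)
    · rw [Finset.sum_range_succ', h2 i v hv]
      have : a i + v * ψ i v - (∑ k ∈ Finset.range m, b k * v ^ (k + 1) + a i * v ^ 0) =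
          v * (ψ i v - ∑ k ∈ Finset.range m, b k * v ^ k) := by
        rw [mul_sub, Finset.mul_sum]
        have : ∑ k ∈ Finset.range m, v * (b k * v ^ k) =
          ∑ k ∈ Finset.range m, b k * v ^ (k + 1) :=
          Finset.sum_congr rfl fun k _ => by ring
        rw [this]; ring
      change |a i + v * ψ i v - (∑ k ∈ Finset.range m, b k * v ^ (k + 1) + a i * v ^ 0)| ≤ _
      rw [this, abs_mul]
      calc |v| * _ ≤ |v| * (L * |v| ^ m) := by gcongr; exact hb' v hv
        _ = L * |v| ^ (m + 1) := by ring
        _ ≤ _ := by gcongr; exact le_max_right _ _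

lemma of_bdd_step {B : ℝ} (hB : ∀ i, ∀ v ∈ S i, |v| ≤ B) (hS : ∀ i, (0 : ℝ) ∉ S i)
    {m : ℕ} {w : ι → ℝ → ℝ} {b : ℕ → ι → ℝ}
    (hb : ∀ k < m, ∃ K : ℝ, ∀ i, |b k i| ≤ K)
    (h1 : ∃ K : ℝ, ∀ i, ∀ v ∈ S i, |w i v - 1| ≤ K * |v|)
    (h2 : ∃ K : ℝ, ∀ i, ∀ v ∈ S i, |w i v ^ 2 + ∑ k ∈ Finset.range m,
      b k i * v ^ (k + 1) * w i v ^ (k + 3) - 1| ≤ K * |v| ^ (m + 1)) :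
    ∀ j ≤ m + 1, WspE S j w := by
  have zr : ∀ (j : ℕ) (r : ι → ℝ → ℝ), (∃ K : ℝ, ∀ i, ∀ v ∈ S i, |r i v| ≤ K * |v| ^ j) →
      WspE S j r := by
    rintro j r ⟨K, hK⟩
    have h0 : WspE S 0 (fun i v => r i v / v ^ j) := ⟨K, fun i v hv => by
      have hv0 : 0 < |v| := abs_pos.2 fun h => hS i (h ▸ hv)
      rw [abs_div, abs_pow, div_le_iff₀ (by positivity)]
      exact hK i v hv⟩
    have := vpow h0 j
    rw [zero_add] at this
    refine this.congr fun i v hv => ?_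
    have hv0 : v ≠ 0 := fun h => hS i (h ▸ hv)
    field_simp
  have one : ∀ j, WspE S j (fun _ _ => (1 : ℝ)) := const (c := fun _ => 1) ⟨1, fun i => by simp⟩
  have neg : ∀ j (φ : ι → ℝ → ℝ), WspE S j φ → WspE S j (fun i v => (-1) * φ i v) :=
    fun j φ h => cmul (c := fun _ => -1) ⟨1, fun i => by simp⟩ h
  have half : ∀ j (φ : ι → ℝ → ℝ), WspE S j φ → WspE S j (fun i v => (1/2) * φ i v) :=
    fun j φ h => cmul (c := fun _ => 1/2) ⟨1/2, fun i => by norm_num⟩ h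
  have hw1 : WspE S 1 (fun i v => w i v - 1) := zr 1 _ (by simpa using h1)
  obtain ⟨a1, ha1, d, hd, hd'⟩ : ∃ a1 : ι → ℝ, True ∧ ∃ d : ι → ℝ → ℝ, WspE S 0 d ∧
      ∀ i, ∀ v ∈ S i, w i v - 1 = v * d i v := by
    obtain ⟨K, hK⟩ := h1
    refine ⟨fun _ => 0, trivial, fun i v => (w i v - 1) / v, ⟨K, fun i v hv => ?_⟩,
      fun i v hv => ?_⟩
    · have hv0 : 0 < |v| := abs_pos.2 fun h => hS i (h ▸ hv)
      rw [abs_div, div_le_iff₀ (by positivity)]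
      exact hK i v hv
    · have hv0 : v ≠ 0 := fun h => hS i (h ▸ hv)
      field_simp
  have hw1' : WspE S 1 w := (hw1.add (one 1)).congr fun i v hv => by ring
  intro j
  induction j with
  | zero => intro _; exact of_succ hB hw1'
  | succ j ih =>
    intro hj
    rcases Nat.eq_zero_or_pos j with rfl | hjpos
    · exact hw1'
    have hwj := ih (by omega)
    obtain ⟨P, e, hP, he, hPe⟩ := split hB hwj
    have hres := zr _ _ h2
    have hsum : WspE S (j + 1) (fun i v => ∑ k ∈ Finset.range m,
        b k i * v ^ (k + 1) * w i v ^ (k + 3)) := by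
      refine sum _ fun k hk => ?_
      have := cmul (hb k (Finset.mem_range.1 hk)) (vpow (pow hB hwj (k + 3)) (k + 1))
      exact (of_le hB (by omega) this).congr fun i v hv => by ring
    have hsq : WspE S (j + 1) (fun i v => w i v ^ 2) :=
      (((of_le hB hj hres).add (neg _ _ hsum)).add (one _)).congr fun i v hv => by ring
    -- w = P + (w^2 - P^2)/2 + (2 - w - P)/2 * (w - P)
    -- 2 - w - P = - 2 v d + v^j e
    obtain ⟨q, rfl⟩ : ∃ q, j = q + 1 := ⟨j - 1, by omega⟩
    have hvq : WspE S 0 (fun _ v => v ^ q) := ⟨|B| ^ q, fun i v hv => by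
      rw [abs_pow]; exact pow_le_pow_left₀ (abs_nonneg _) ((hB i v hv).trans (le_abs_self _)) _⟩
    have hcor : WspE S (0 + (q + 1 + 1)) (fun i v => v ^ (q + 1 + 1) *
        (1/2 * ((-1) * (d i v + d i v) + v ^ q * e i v) * e i v)) :=
      vpow (mul hB (half _ _ ((neg _ _ (hd.add hd)).add (mul hB hvq he))) he) _
    rw [zero_add] at hcor
    refine (((hP _).add (half _ _ (hsq.add (neg _ _ (pow hB (hP _) 2))))).add hcor).congr
      fun i v hv => ?_
    have e1 := hPe i v hv
    have e2 := hd' i v hv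
    have e3 : w i v = 1 + v * d i v := by linarith
    have e4 : P i v = 1 + v * d i v - v ^ (q + 1) * e i v := by linarith
    rw [e4, e3]; ring

end WspE

lemma wsp_core (m : ℕ) (B : ℝ) : ∃ K : ℝ, 0 ≤ K ∧ ∀ (ρ : ℝ) (w : ℝ → ℝ) (b : ℕ → ℝ),
    0 < ρ → ρ ≤ B → (∀ k < m, |b k| ≤ B) →
    (∀ v, v ≠ 0 → |v| ≤ ρ → |w v - 1| ≤ B * |v| ∧
      |w v ^ 2 + ∑ k ∈ Finset.range m, b k * v ^ (k + 1) * w v ^ (k + 3) - 1|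
        ≤ B * |v| ^ (m + 1)) →
    ∀ l, 1 ≤ l → l ≤ m → ∃ c : ℕ → ℝ, (∀ k, |c k| ≤ K) ∧ (∀ k < l, c k = 0) ∧
      (l = 1 → c 1 = 1) ∧ ∀ v, v ≠ 0 → |v| ≤ ρ →
        |(v * w v) ^ l - ∑ k ∈ Finset.range (m + 1), c k * v ^ k| ≤ K * |v| ^ (m + 1) := by
  let ι := {t : ℝ × (ℝ → ℝ) × (ℕ → ℝ) // 0 < t.1 ∧ t.1 ≤ B ∧ (∀ k < m, |t.2.2 k| ≤ B) ∧
    (∀ v, v ≠ 0 → |v| ≤ t.1 → |t.2.1 v - 1| ≤ B * |v| ∧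
      |t.2.1 v ^ 2 + ∑ k ∈ Finset.range m, t.2.2 k * v ^ (k + 1) * t.2.1 v ^ (k + 3) - 1|
        ≤ B * |v| ^ (m + 1))}
  let S : ι → Set ℝ := fun i => {v | v ≠ 0 ∧ |v| ≤ i.1.1}
  have hB : ∀ i, ∀ v ∈ S i, |v| ≤ B := fun i v hv => hv.2.trans i.2.2.1
  have hw := WspE.of_bdd_step (S := S) hB (fun i h => h.1 rfl) (m := m)
    (w := fun i => i.1.2.1) (b := fun k i => i.1.2.2 k)
    (fun k hk => ⟨B, fun i => i.2.2.2.1 k hk⟩)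
    ⟨B, fun i v hv => (i.2.2.2.2 v hv.1 hv.2).1⟩ ⟨B, fun i v hv => (i.2.2.2.2 v hv.1 hv.2).2⟩
  have hl : ∀ l : ℕ, ∃ K : ℝ, 0 ≤ K ∧ ∀ i : ι, ∃ a : ℕ → ℝ, (∀ k, |a k| ≤ K) ∧
      ∀ v ∈ S i, |i.1.2.1 v ^ l - ∑ k ∈ Finset.range (m + 1 - l), a k * v ^ k| ≤
        K * |v| ^ (m + 1 - l) :=
    fun l => WspE.coeffs (WspE.pow hB (hw (m + 1 - l) (by omega)) l)
  choose Kf hK0 hKf using hl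
  refine ⟨∑ l ∈ Finset.range (m + 1), Kf l, Finset.sum_nonneg fun l _ => hK0 l, ?_⟩
  intro ρ w b h0 h1 h2 h3 l hl1 hlm
  have hle : Kf l ≤ ∑ l ∈ Finset.range (m + 1), Kf l :=
    Finset.single_le_sum (fun l _ => hK0 l) (Finset.mem_range.2 (by omega))
  obtain ⟨a, ha, ha'⟩ := hKf l ⟨(ρ, w, b), h0, h1, h2, h3⟩
  change ∀ v ∈ {v | v ≠ 0 ∧ |v| ≤ ρ}, |w v ^ l - _| ≤ _ at ha'
  obtain ⟨p, hp⟩ : ∃ p, m + 1 = l + p := ⟨m + 1 - l, by omega⟩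
  rw [show m + 1 - l = p by omega] at ha'
  refine ⟨fun k => if k < l then 0 else a (k - l), fun k => ?_, fun k hk => by simp [hk], ?_, ?_⟩
  · beta_reduce
    split_ifs
    · simpa using (hK0 l).trans hle
    · exact (ha _).trans hle
  · rintro rfl
    simp only [lt_irrefl, if_false, Nat.sub_self]
    -- w → 1
    obtain ⟨q, rfl⟩ : ∃ q, p = q + 1 := ⟨p - 1, by omega⟩
    have hE : ∃ E : ℝ, ∀ v ∈ {v | v ≠ 0 ∧ |v| ≤ ρ}, |a 0 - 1| ≤ |v| * E := by
      refine ⟨B + ∑ k ∈ Finset.range q, Kf 1 * ρ ^ k + Kf 1 * ρ ^ q, fun v hv => ?_⟩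
      have e1 := (h3 v hv.1 hv.2).1
      have e2 := ha' v hv
      rw [Finset.sum_range_succ'] at e2
      have e3 : |∑ k ∈ Finset.range q, a (k + 1) * v ^ (k + 1)| ≤
          |v| * ∑ k ∈ Finset.range q, Kf 1 * ρ ^ k := by
        rw [Finset.mul_sum]
        refine (Finset.abs_sum_le_sum_abs _ _).trans (Finset.sum_le_sum fun k _ => ?_)
        rw [abs_mul, abs_pow, pow_succ]
        have := pow_le_pow_left₀ (abs_nonneg v) hv.2 k
        calc |a (k + 1)| * (|v| ^ k * |v|) ≤ Kf 1 * (ρ ^ k * |v|) := by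
              gcongr
              · exact hK0 1
              · exact ha _
          _ = _ := by ring
      have e4 : Kf 1 * |v| ^ (q + 1) ≤ |v| * (Kf 1 * ρ ^ q) := by
        have := pow_le_pow_left₀ (abs_nonneg v) hv.2 q
        calc Kf 1 * |v| ^ (q + 1) = |v| * (Kf 1 * |v| ^ q) := by ring
          _ ≤ _ := by
            have := hK0 1
            gcongr
      have e5 := e2.trans e4
      simp only [pow_one, pow_zero, mul_one] at e5
      rw [abs_le] at *
      constructor <;> nlinarith [e1.1, e1.2, e3.1, e3.2, e5.1, e5.2]
    obtain ⟨E, hE⟩ := hE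
    by_contra hne
    have hpos : 0 < |a 0 - 1| := abs_pos.2 (sub_ne_zero.2 hne)
    have hE0 : 0 ≤ |E| := abs_nonneg E
    set v := min ρ (|a 0 - 1| / (2 * (|E| + 1))) with hv
    have hvpos : 0 < v := lt_min h0 (by positivity)
    have := hE v ⟨hvpos.ne', by rw [abs_of_pos hvpos]; exact min_le_left _ _⟩
    rw [abs_of_pos hvpos] at this
    have h5 : v ≤ |a 0 - 1| / (2 * (|E| + 1)) := min_le_right _ _
    rw [le_div_iff₀ (by positivity)] at h5
    nlinarith [le_abs_self E, mul_le_mul_of_nonneg_left (le_abs_self E) hvpos.le]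
  · intro v hv0 hv
    rw [hp, Finset.sum_range_add]
    have e1 : ∑ x ∈ Finset.range l, (if x < l then 0 else a (x - l)) * v ^ x = 0 :=
      Finset.sum_eq_zero fun x hx => by simp [Finset.mem_range.1 hx]
    have e2 : ∑ x ∈ Finset.range p, (if l + x < l then 0 else a (l + x - l)) * v ^ (l + x) =
        v ^ l * ∑ x ∈ Finset.range p, a x * v ^ x := by
      rw [Finset.mul_sum]
      refine Finset.sum_congr rfl fun x _ => ?_
      rw [if_neg (by omega), Nat.add_sub_cancel_left]; ring
    rw [e1, e2, zero_add, mul_pow, ← mul_sub, abs_mul, abs_pow, pow_add]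
    have := ha' v ⟨hv0, hv⟩
    calc _ ≤ |v| ^ l * (Kf l * |v| ^ p) := by gcongr
      _ ≤ |v| ^ l * ((∑ l ∈ Finset.range (m + 1), Kf l) * |v| ^ p) := by gcongr
      _ = _ := by rw [hp]; ring

lemma wsp_rem {c2 cp T M lam y h w D F : ℝ} {q : ℕ} (hc2 : 0 < c2) (hcp : 0 < cp) (hT : 0 < T)
    (hM : 0 < M) (hlam : T / (2 * c2 * M ^ 2) ≤ lam) (hy : y ≠ 0) (hw : 0 < w) (hwc : w ≤ c2)
    (hh : h = w * y) (hF : 1 ≤ F) (hD : |D| ≤ cp * T / M ^ (q + 2)) :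
    |D * h ^ (q + 2) / F / (lam * y ^ 2)| ≤ 2 * c2 * cp * c2 ^ (q + 2) * |y / M| ^ q := by
  have hlam0 : 0 < lam := lt_of_lt_of_le (by positivity) hlam
  have hya : 0 < |y| := abs_pos.2 hy
  have hl2 : T ≤ lam * (2 * c2 * M ^ 2) := (div_le_iff₀ (by positivity)).1 hlam
  rw [hh, abs_div, abs_div, abs_mul, abs_pow, abs_mul, abs_of_pos hw, abs_of_pos (a := F) (by linarith),
    abs_mul, abs_of_pos hlam0, abs_pow, abs_div, abs_of_pos hM, div_le_iff₀ (by positivity)]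
  calc |D| * (w * |y|) ^ (q + 2) / F ≤ |D| * (w * |y|) ^ (q + 2) := div_le_self (by positivity) hF
    _ ≤ (cp * T / M ^ (q + 2)) * (c2 * |y|) ^ (q + 2) := by gcongr
    _ ≤ (cp * (lam * (2 * c2 * M ^ 2)) / M ^ (q + 2)) * (c2 * |y|) ^ (q + 2) := by gcongr
    _ = _ := by
      rw [div_pow, mul_pow, pow_add M, pow_add |y|]
      field_simp

lemma wsp_phase (n : ℕ) (C : ℕ → ℝ) (hC : ∀ k, 0 < C k)
    {α β γ M T lam x y : ℝ} {f : ℝ → ℝ} (hαγ : α < γ) (hγβ : γ < β) (hM : 0 < M) (hT : 0 < T)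
    (hf : ContDiffOn ℝ ((2 * n + 3 : ℕ) : WithTop ℕ∞) f (Set.Icc α β))
    (hf1 : derivWithin f (Set.Icc α β) γ = 0)
    (hfr : ∀ r, 2 ≤ r → r ≤ 2 * n + 3 → ∀ x ∈ Set.Icc α β,
          |iteratedDerivWithin r f (Set.Icc α β) x| ≤ C r * T / M ^ r)
    (hf2 : ∀ x ∈ Set.Icc α β,
          T / (C 2 * M ^ 2) ≤ iteratedDerivWithin 2 f (Set.Icc α β) x)
    (hlam : lam = iteratedDerivWithin 2 f (Set.Icc α β) γ / 2)
    (hy : y ≠ 0) (hx : x ∈ Set.Icc α β) (hxy : 0 < (x - γ) / y)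
    (hfx : f x = f γ + lam * y ^ 2) :
    (x - γ) / y ≤ C 2 ∧ |(x - γ) / y - 1| ≤ 2 * C 2 * C 3 * C 2 ^ 3 * |y / M| ∧
    (∀ k < 2 * n, |iteratedDerivWithin (k + 3) f (Set.Icc α β) γ * M ^ (k + 1) /
        ((k + 3).factorial * lam)| ≤ 2 * C 2 * C (k + 3)) ∧
    |((x - γ) / y) ^ 2 + ∑ k ∈ Finset.range (2 * n),
      (iteratedDerivWithin (k + 3) f (Set.Icc α β) γ * M ^ (k + 1) /
        ((k + 3).factorial * lam)) * (y / M) ^ (k + 1) * ((x - γ) / y) ^ (k + 3) - 1| ≤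
      2 * C 2 * C (2 * n + 3) * C 2 ^ (2 * n + 3) * |y / M| ^ (2 * n + 1) := by
  have hγ : γ ∈ Set.Icc α β := ⟨hαγ.le, hγβ.le⟩
  have hc2 := hC 2
  have hl1 : T / (2 * C 2 * M ^ 2) ≤ lam := by
    have := hf2 γ hγ
    rw [hlam]
    calc T / (2 * C 2 * M ^ 2) = T / (C 2 * M ^ 2) / 2 := by field_simp
      _ ≤ _ := by linarith
  have hlam0 : 0 < lam := lt_of_lt_of_le (by positivity) hl1
  have hl2 : lam ≤ C 2 * T / M ^ 2 / 2 := by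
    have := (le_abs_self _).trans (hfr 2 le_rfl (by omega) γ hγ)
    rw [hlam]; linarith
  set w := (x - γ) / y with hw
  have hh : x - γ = w * y := by rw [hw]; field_simp
  have hne : γ ≠ x := by
    rintro rfl
    simp at hw; linarith
  have hT' : ∀ m, m + 1 ≤ 2 * n + 3 → _ := fun m hm =>
    wsp_taylor hγ hx hne m (hf.of_le (by exact_mod_cast hm))
  have hwc : w ≤ C 2 := by
    obtain ⟨ξ, hξ, e⟩ := hT' 1 (by omega)
    simp only [Finset.sum_range_succ, Finset.sum_range_zero, iteratedDerivWithin_zero,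
      iteratedDerivWithin_one, hf1, hfx, hh] at e
    norm_num [Nat.factorial] at e
    have h2 := hf2 ξ hξ
    have hy2 : 0 < y ^ 2 := by positivity
    have e' : lam = iteratedDerivWithin 2 f (Set.Icc α β) ξ * w ^ 2 / 2 := by
      field_simp
      field_simp at e
      linarith
    have h3 : T / (C 2 * M ^ 2) * w ^ 2 ≤ C 2 * T / M ^ 2 := by
      nlinarith [sq_nonneg w]
    have h4 : w ^ 2 ≤ C 2 ^ 2 := by
      rw [div_mul_eq_mul_div, div_le_div_iff₀ (by positivity) (by positivity)] at h3
      have : 0 < T * M ^ 2 := by positivity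
      nlinarith
    exact le_of_sq_le_sq h4 hc2.le
  refine ⟨hwc, ?_, ?_, ?_⟩
  · obtain ⟨ξ, hξ, e⟩ := hT' 2 (by omega)
    have hr := wsp_rem (q := 1) hc2 (hC 3) hT hM hl1 hy hxy hwc hh
      (F := ((2 + 1).factorial : ℝ)) (by norm_num [Nat.factorial]) (hfr 3 (by omega) (by omega) ξ hξ)
    rw [show (1 + 2 : ℕ) = 2 + 1 from rfl, ← e] at hr
    simp only [Finset.sum_range_succ, Finset.sum_range_zero, iteratedDerivWithin_zero,
      iteratedDerivWithin_one, hf1, hfx, hh] at hr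
    rw [show iteratedDerivWithin 2 f (Set.Icc α β) γ = 2 * lam by rw [hlam]; ring] at hr
    norm_num [Nat.factorial] at hr
    have e1 : (lam * y ^ 2 - lam * (w * y) ^ 2) / (lam * y ^ 2) = 1 - w ^ 2 := by
      field_simp
    rw [e1] at hr
    have : |w - 1| ≤ |1 - w ^ 2| := by
      rw [show 1 - w ^ 2 = -((w - 1) * (w + 1)) by ring, abs_neg, abs_mul,
        abs_of_pos (a := w + 1) (by linarith)]
      nlinarith [abs_nonneg (w - 1)]
    simpa using this.trans hr
  · intro k hk
    have h1 := hfr (k + 3) (by omega) (by omega) γ hγ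
    have hF : (1 : ℝ) ≤ ((k + 3).factorial : ℝ) := by exact_mod_cast Nat.one_le_iff_ne_zero.2 (Nat.factorial_ne_zero _)
    have hl3 : T ≤ lam * (2 * C 2 * M ^ 2) := (div_le_iff₀ (by positivity)).1 hl1
    have hc3 := hC (k + 3)
    rw [abs_div, abs_mul, abs_mul, abs_of_pos hlam0, abs_of_pos (a := M ^ (k + 1)) (by positivity),
      abs_of_pos (a := ((k + 3).factorial : ℝ)) (by linarith), div_le_iff₀ (by positivity)]
    calc _ ≤ C (k + 3) * T / M ^ (k + 3) * M ^ (k + 1) := by gcongr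
      _ ≤ C (k + 3) * (lam * (2 * C 2 * M ^ 2)) / M ^ (k + 3) * M ^ (k + 1) := by gcongr
      _ = 2 * C 2 * C (k + 3) * (1 * lam) := by
        rw [show k + 3 = (k + 1) + 2 by ring, pow_add M (k + 1) 2]; field_simp
      _ ≤ _ := by gcongr
  · obtain ⟨ξ, hξ, e⟩ := hT' (2 * n + 2) (by omega)
    have hr := wsp_rem (q := 2 * n + 1) hc2 (hC (2 * n + 3)) hT hM hl1 hy hxy hwc hh
      (F := ((2 * n + 2 + 1).factorial : ℝ))
      (by exact_mod_cast Nat.one_le_iff_ne_zero.2 (Nat.factorial_ne_zero _))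
      (hfr (2 * n + 3) (by omega) (by omega) ξ hξ)
    rw [show (2 * n + 1 + 2 : ℕ) = 2 * n + 2 + 1 from rfl, ← e] at hr
    rw [Finset.sum_range_succ', Finset.sum_range_succ', Finset.sum_range_succ'] at hr
    simp only [zero_add, iteratedDerivWithin_zero, iteratedDerivWithin_one, hf1, hfx, hh] at hr
    rw [show iteratedDerivWithin (1 + 1) f (Set.Icc α β) γ = 2 * lam by rw [hlam]; ring] at hr
    refine le_trans (le_of_eq ?_) hr
    rw [← abs_neg]
    congr 1
    rw [eq_div_iff (by positivity)]
    have hs : (∑ k ∈ Finset.range (2 * n), (iteratedDerivWithin (k + 3) f (Set.Icc α β) γ *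
        M ^ (k + 1) / ((k + 3).factorial * lam)) * (y / M) ^ (k + 1) * w ^ (k + 3)) *
          (lam * y ^ 2) = ∑ k ∈ Finset.range (2 * n),
        iteratedDerivWithin (k + 1 + 1 + 1) f (Set.Icc α β) γ / ((k + 1 + 1 + 1).factorial : ℝ) *
          (w * y) ^ (k + 1 + 1 + 1) := by
      rw [Finset.sum_mul]
      refine Finset.sum_congr rfl fun k _ => ?_
      have hF : ((k + 3).factorial : ℝ) ≠ 0 := by exact_mod_cast Nat.factorial_ne_zero _
      change _ = iteratedDerivWithin (k + 3) f (Set.Icc α β) γ / ((k + 3).factorial : ℝ) *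
          (w * y) ^ (k + 3)
      rw [div_pow, mul_pow, show y ^ (k + 3) = y ^ (k + 1) * y ^ 2 by ring]
      field_simp
    rw [← hs]
    norm_num [Nat.factorial]
    ring

lemma wsp_pow {R : ℝ} (hR : 0 < R) {l k : ℕ} (h1 : 1 ≤ l) (hk : l ≤ k) : R ^ l ≤ R + R ^ k := by
  rcases le_total R 1 with h | h
  · have := pow_le_of_le_one hR.le h (n := l) (by omega)
    have := pow_pos hR k
    linarith
  · have := pow_le_pow_right₀ h hk
    linarith

theorem weighted_stationary_phase_stmt10
    (n : ℕ) (hn : 2 ≤ n) (C : ℕ → ℝ) (hC : ∀ k, 0 < C k) :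
    ∃ K : ℝ, 0 < K ∧
      ∀ (α β γ M N T U r1 r2 : ℝ) (f g xof : ℝ → ℝ),
        α < γ → γ < β → 0 < M → 0 < N → 0 < T → 0 < U → β - α ≤ M →
        ContDiffOn ℝ (2 * n + 3) f (Set.Icc α β) →
        ContDiffOn ℝ (2 * n + 1) g (Set.Icc α β) →
        derivWithin f (Set.Icc α β) γ = 0 →
        (∀ r, 2 ≤ r → r ≤ 2 * n + 3 → ∀ x ∈ Set.Icc α β,
          |iteratedDerivWithin r f (Set.Icc α β) x| ≤ C r * T / M ^ r) →
        (∀ x ∈ Set.Icc α β,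
          T / (C 2 * M ^ 2) ≤ iteratedDerivWithin 2 f (Set.Icc α β) x) →
        (∀ s, s ≤ 2 * n + 1 → ∀ x ∈ Set.Icc α β,
          |iteratedDerivWithin s g (Set.Icc α β) x| ≤ C s * U / N ^ s) →
        let lam2 : ℝ := iteratedDerivWithin 2 f (Set.Icc α β) γ / 2
        let Δ : ℝ := min (Real.log 2 / C 2)
          (1 / ((C 2) ^ 2 *
            (Finset.Icc 2 (2 * n + 3)).sup' (Finset.nonempty_Icc.mpr (by omega)) C))
        0 < r1 → 0 < r2 →
        f α = f γ + lam2 * r1 ^ 2 →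
        f β = f γ + lam2 * r2 ^ 2 →
        xof 0 = γ →
        (∀ y ∈ Set.Icc (-r1) r2, xof y ∈ Set.Icc α β ∧
          f (xof y) = f γ + lam2 * y ^ 2 ∧
          (y < 0 → xof y < γ) ∧ (0 < y → γ < xof y)) →
        ∃ η : ℕ → ℝ,
          η 0 = g γ ∧
          η 1 = derivWithin g (Set.Icc α β) γ ∧
          (∀ k, 1 ≤ k → k ≤ 2 * n →
            |η k| ≤ K * U * (1 / N ^ k + 1 / (N * M ^ (k - 1)))) ∧
          ∀ y : ℝ, |y| ≤ min r1 (min r2 (Δ * M)) →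
            |g (xof y) - ∑ k ∈ Finset.range (2 * n + 1), η k * y ^ k| ≤
              K * (U * |y| ^ (2 * n + 1) * (1 / (N * M ^ (2 * n)) + 1 / N ^ (2 * n + 1))) := by
  have hc2 := hC 2
  have hlog : 0 < Real.log 2 := Real.log_pos (by norm_num)
  obtain ⟨B, hB1, hB2, hB3, hB4⟩ : ∃ B : ℝ, Real.log 2 / C 2 ≤ B ∧
      2 * C 2 * C 3 * C 2 ^ 3 ≤ B ∧
      2 * C 2 * C (2 * n + 3) * C 2 ^ (2 * n + 3) ≤ B ∧
      ∀ k < 2 * n, 2 * C 2 * C (k + 3) ≤ B := by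
    have hc3 := hC 3
    have hcn := hC (2 * n + 3)
    have hs : ∀ k ∈ Finset.range (2 * n), 0 ≤ 2 * C 2 * C (k + 3) := fun k _ => by
      have := hC (k + 3); positivity
    have h1 : 0 ≤ Real.log 2 / C 2 := by positivity
    have h2 : 0 ≤ 2 * C 2 * C 3 * C 2 ^ 3 := by positivity
    have h3 : 0 ≤ 2 * C 2 * C (2 * n + 3) * C 2 ^ (2 * n + 3) := by positivity
    have h4 := Finset.sum_nonneg hs
    refine ⟨Real.log 2 / C 2 + 2 * C 2 * C 3 * C 2 ^ 3 +
      2 * C 2 * C (2 * n + 3) * C 2 ^ (2 * n + 3) +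
      ∑ k ∈ Finset.range (2 * n), 2 * C 2 * C (k + 3), by linarith, by linarith, by linarith,
      fun k hk => ?_⟩
    have := Finset.single_le_sum hs (Finset.mem_range.2 hk)
    linarith
  obtain ⟨K0, hK0, hcore⟩ := wsp_core (2 * n) B
  set A := ∑ l ∈ Finset.Ico 1 (2 * n + 1), C l with hA
  have hA0 : 0 ≤ A := Finset.sum_nonneg fun l _ => (hC l).le
  have hCm := hC (2 * n + 1)
  refine ⟨K0 * A + C (2 * n + 1) * C 2 ^ (2 * n + 1), by positivity, ?_⟩
  intro α β γ M N T U r1 r2 f g xof hαγ hγβ hM hN hT hU _ hf hg hf1 hfr hf2 hgs lam2 Δ hr1 hr2 _ _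
    hx0 hxof
  have hf' : ContDiffOn ℝ ((2 * n + 3 : ℕ) : WithTop ℕ∞) f (Set.Icc α β) := by exact_mod_cast hf
  have hg' : ContDiffOn ℝ ((2 * n + 1 : ℕ) : WithTop ℕ∞) g (Set.Icc α β) := by exact_mod_cast hg
  have hγ : γ ∈ Set.Icc α β := ⟨hαγ.le, hγβ.le⟩
  have hΔ : 0 < Δ := by
    refine lt_min (by positivity) ?_
    have : 0 < (Finset.Icc 2 (2 * n + 3)).sup' (Finset.nonempty_Icc.mpr (by omega)) C :=
      (hC 2).trans_le (Finset.le_sup' C (Finset.mem_Icc.2 ⟨le_rfl, by omega⟩))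
    positivity
  set ρ0 := min r1 (min r2 (Δ * M)) with hρ0
  have hρ0pos : 0 < ρ0 := lt_min hr1 (lt_min hr2 (by positivity))
  have hρ0M : ρ0 / M ≤ B := by
    rw [div_le_iff₀ hM]
    calc ρ0 ≤ Δ * M := (min_le_right _ _).trans (min_le_right _ _)
      _ ≤ B * M := by
        gcongr
        exact (min_le_left _ _).trans hB1
  have hph0 : ∀ y, y ≠ 0 → |y| ≤ ρ0 → 0 < (xof y - γ) / y ∧ xof y ∈ Set.Icc α β ∧
      f (xof y) = f γ + lam2 * y ^ 2 := by
    intro y hy hyρ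
    have hy1 : |y| ≤ r1 := hyρ.trans (min_le_left _ _)
    have hy2 : |y| ≤ r2 := hyρ.trans ((min_le_right _ _).trans (min_le_left _ _))
    obtain ⟨h1, h2, h3, h4⟩ := hxof y ⟨by linarith [neg_abs_le y], by linarith [le_abs_self y]⟩
    have hpos : 0 < (xof y - γ) / y := by
      rcases lt_or_gt_of_ne hy with h | h
      · exact div_pos_of_neg_of_neg (by linarith [h3 h]) h
      · exact div_pos (by linarith [h4 h]) h
    exact ⟨hpos, h1, h2⟩
  have hph := fun (y : ℝ) (hy : y ≠ 0) (hyρ : |y| ≤ ρ0) =>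
    And.intro (hph0 y hy hyρ).1 (And.intro (hph0 y hy hyρ).2.1
      (wsp_phase n C hC hαγ hγβ hM hT hf' hf1 hfr hf2 (lam := lam2) rfl hy (hph0 y hy hyρ).2.1
        (hph0 y hy hyρ).1 (hph0 y hy hyρ).2.2))
  have hcore' := hcore (ρ0 / M) (fun v => (xof (M * v) - γ) / (M * v))
    (fun k => iteratedDerivWithin (k + 3) f (Set.Icc α β) γ * M ^ (k + 1) /
        ((k + 3).factorial * lam2)) (by positivity) hρ0M
    (fun k hk => by
      obtain ⟨_, _, _, _, h, _⟩ := hph ρ0 hρ0pos.ne' (by rw [abs_of_pos hρ0pos])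
      exact (h k hk).trans (hB4 k hk))
    (fun v hv0 hv => by
      have hle : |M * v| ≤ ρ0 := by
        rw [abs_mul, abs_of_pos hM]; rw [le_div_iff₀ hM] at hv; linarith
      obtain ⟨_, _, _, h1, _, h2⟩ := hph (M * v) (mul_ne_zero hM.ne' hv0) hle
      rw [mul_div_cancel_left₀ _ hM.ne'] at h1 h2
      exact ⟨h1.trans (by gcongr), h2.trans (by gcongr)⟩)
  have hcc : ∀ l, ∃ c : ℕ → ℝ, 1 ≤ l → l ≤ 2 * n → (∀ k, |c k| ≤ K0) ∧ (∀ k < l, c k = 0) ∧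
      (l = 1 → c 1 = 1) ∧ ∀ y, y ≠ 0 → |y| ≤ ρ0 →
        |((xof y - γ) / M) ^ l - ∑ k ∈ Finset.range (2 * n + 1), c k * (y / M) ^ k| ≤
          K0 * |y / M| ^ (2 * n + 1) := by
    intro l
    by_cases hl : 1 ≤ l ∧ l ≤ 2 * n
    · obtain ⟨c, h1, h2, h3, h4⟩ := hcore' l hl.1 hl.2
      refine ⟨c, fun _ _ => ⟨h1, h2, h3, fun y hy hyρ => ?_⟩⟩
      have := h4 (y / M) (div_ne_zero hy hM.ne')
        (by rw [abs_div, abs_of_pos hM]; gcongr)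
      rw [mul_div_cancel₀ _ hM.ne'] at this
      rwa [show y / M * ((xof y - γ) / y) = (xof y - γ) / M by field_simp] at this
    · exact ⟨0, fun h1 h2 => (hl ⟨h1, h2⟩).elim⟩
  choose c hc using hcc
  set R := M / N with hR
  have hR0 : 0 < R := by positivity
  set G : ℕ → ℝ := fun l => iteratedDerivWithin l g (Set.Icc α β) γ / (l.factorial : ℝ) * M ^ l
    with hG
  have hGb : ∀ l ≤ 2 * n, |G l| ≤ C l * U * R ^ l := by
    intro l hl
    have h1 := hgs l (by omega) γ hγ
    have hF : (1 : ℝ) ≤ (l.factorial : ℝ) := by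
      exact_mod_cast Nat.one_le_iff_ne_zero.2 (Nat.factorial_ne_zero _)
    rw [hG]
    simp only [abs_mul, abs_div, abs_pow, abs_of_pos hM]
    rw [abs_of_pos (a := (l.factorial : ℝ)) (by linarith)]
    calc _ ≤ |iteratedDerivWithin l g (Set.Icc α β) γ| * M ^ l := by
          gcongr; exact div_le_self (abs_nonneg _) hF
      _ ≤ C l * U / N ^ l * M ^ l := by gcongr
      _ = _ := by rw [hR, div_pow]; ring
  set θ : ℕ → ℝ := fun k => ∑ l ∈ Finset.Ico 1 (2 * n + 1), G l * c l k with hθ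
  refine ⟨fun k => (if k = 0 then g γ else 0) + θ k / M ^ k, ?_, ?_, ?_, ?_⟩
  · have : θ 0 = 0 := Finset.sum_eq_zero fun l hl => by
      rw [Finset.mem_Ico] at hl
      rw [(hc l hl.1 (by omega)).2.1 0 (by omega), mul_zero]
    simp [this]
  · have : θ 1 = G 1 := by
      rw [hθ]
      beta_reduce
      rw [Finset.sum_eq_single 1]
      · rw [(hc 1 le_rfl (by omega)).2.2.1 rfl, mul_one]
      · intro l hl hl1
        rw [Finset.mem_Ico] at hl
        rw [(hc l hl.1 (by omega)).2.1 1 (by omega), mul_zero]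
      · intro h; exact (h (Finset.mem_Ico.2 ⟨le_rfl, by omega⟩)).elim
    simp [this, hG, iteratedDerivWithin_one, hM.ne']
  · intro k hk1 hk2
    have h1 : |θ k| ≤ K0 * A * U * (R + R ^ k) := by
      rw [hθ, hA]
      refine (Finset.abs_sum_le_sum_abs _ _).trans ?_
      rw [Finset.mul_sum, Finset.sum_mul, Finset.sum_mul]
      refine Finset.sum_le_sum fun l hl => ?_
      rw [Finset.mem_Ico] at hl
      have hcl := hc l hl.1 (by omega)
      have hCl := hC l
      rcases lt_or_ge k l with hkl | hkl
      · rw [hcl.2.1 k hkl, mul_zero, abs_zero]; positivity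
      · rw [abs_mul]
        have := hGb l (by omega)
        have := hcl.1 k
        have := wsp_pow hR0 hl.1 hkl
        calc |G l| * |c l k| ≤ (C l * U * R ^ l) * K0 := by gcongr
          _ ≤ (C l * U * (R + R ^ k)) * K0 := by gcongr
          _ = _ := by ring
    obtain ⟨q, rfl⟩ : ∃ q, k = q + 1 := ⟨k - 1, by omega⟩
    simp only [Nat.add_eq_zero_iff, one_ne_zero, and_false, if_false, zero_add,
      Nat.add_sub_cancel]
    rw [abs_div, abs_of_pos (a := M ^ (q + 1)) (by positivity), div_le_iff₀ (by positivity)]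
    have h2 : (1 / N ^ (q + 1) + 1 / (N * M ^ q)) * M ^ (q + 1) = R + R ^ (q + 1) := by
      rw [hR, div_pow]; field_simp; ring
    rw [mul_assoc, h2]
    refine h1.trans ?_
    have h3 : 0 ≤ C (2 * n + 1) * C 2 ^ (2 * n + 1) := by positivity
    gcongr
    linarith
  · intro y hyρ
    rcases eq_or_ne y 0 with rfl | hy
    · have h0 : θ 0 = 0 := Finset.sum_eq_zero fun l hl => by
        rw [Finset.mem_Ico] at hl
        rw [(hc l hl.1 (by omega)).2.1 0 (by omega), mul_zero]
      rw [Finset.sum_range_succ']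
      simp [h0, hx0]
    obtain ⟨hw0, hxI, hwc, -⟩ := hph y hy hyρ
    have hya : 0 < |y| := abs_pos.2 hy
    have hne : γ ≠ xof y := by
      intro h
      rw [← h] at hw0; simp at hw0
    have hh : |xof y - γ| ≤ C 2 * |y| := by
      have : |(xof y - γ) / y| ≤ C 2 := by rw [abs_of_pos hw0]; exact hwc
      rwa [abs_div, div_le_iff₀ hya] at this
    obtain ⟨ξ, hξ, e⟩ := wsp_taylor hγ hxI hne (2 * n) hg'
    have hrem : |iteratedDerivWithin (2 * n + 1) g (Set.Icc α β) ξ * (xof y - γ) ^ (2 * n + 1) /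
        ((2 * n + 1).factorial : ℝ)| ≤
        C (2 * n + 1) * C 2 ^ (2 * n + 1) * U * |y| ^ (2 * n + 1) * (1 / N ^ (2 * n + 1)) := by
      have hF : (1 : ℝ) ≤ ((2 * n + 1).factorial : ℝ) := by
        exact_mod_cast Nat.one_le_iff_ne_zero.2 (Nat.factorial_ne_zero _)
      have := hgs _ le_rfl ξ hξ
      rw [abs_div, abs_mul, abs_pow, abs_of_pos (a := ((2 * n + 1).factorial : ℝ)) (by linarith)]
      refine (div_le_self (by positivity) hF).trans ?_
      calc _ ≤ C (2 * n + 1) * U / N ^ (2 * n + 1) * (C 2 * |y|) ^ (2 * n + 1) := by gcongr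
        _ = _ := by rw [mul_pow]; ring
    rw [← e] at hrem
    have es : ∑ k ∈ Finset.range (2 * n + 1), iteratedDerivWithin k g (Set.Icc α β) γ /
        (k.factorial : ℝ) * (xof y - γ) ^ k = g γ + ∑ l ∈ Finset.Ico 1 (2 * n + 1),
          G l * ((xof y - γ) / M) ^ l := by
      rw [Finset.range_eq_Ico, Finset.sum_eq_sum_Ico_succ_bot (by omega)]
      congr 1
      · simp
      · refine Finset.sum_congr rfl fun l _ => ?_
        rw [hG, div_pow]; field_simp
    have eη : ∑ k ∈ Finset.range (2 * n + 1), ((if k = 0 then g γ else 0) + θ k / M ^ k) * y ^ k =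
        g γ + ∑ l ∈ Finset.Ico 1 (2 * n + 1), G l *
          ∑ k ∈ Finset.range (2 * n + 1), c l k * (y / M) ^ k := by
      simp only [add_mul, Finset.sum_add_distrib]
      congr 1
      · rw [Finset.sum_range_succ']; simp
      · simp only [Finset.mul_sum]
        rw [Finset.sum_comm]
        refine Finset.sum_congr rfl fun k _ => ?_
        rw [hθ]
        simp only [Finset.sum_div, Finset.sum_mul]
        refine Finset.sum_congr rfl fun l _ => ?_
        rw [div_pow]; ring
    rw [es] at hrem
    rw [eη]
    have hmid : |∑ l ∈ Finset.Ico 1 (2 * n + 1), G l * (((xof y - γ) / M) ^ l -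
          ∑ k ∈ Finset.range (2 * n + 1), c l k * (y / M) ^ k)| ≤
        K0 * A * U * (R + R ^ (2 * n + 1)) * |y / M| ^ (2 * n + 1) := by
      refine (Finset.abs_sum_le_sum_abs _ _).trans ?_
      rw [hA]
      simp only [Finset.mul_sum, Finset.sum_mul]
      refine Finset.sum_le_sum fun l hl => ?_
      rw [Finset.mem_Ico] at hl
      have hcl := (hc l hl.1 (by omega)).2.2.2 y hy hyρ
      have hCl := hC l
      have := hGb l (by omega)
      have := wsp_pow hR0 hl.1 hl.2.le
      rw [abs_mul]
      calc _ ≤ (C l * U * R ^ l) * (K0 * |y / M| ^ (2 * n + 1)) := by gcongr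
        _ ≤ (C l * U * (R + R ^ (2 * n + 1))) * (K0 * |y / M| ^ (2 * n + 1)) := by gcongr
        _ = _ := by ring
    have hconv : (R + R ^ (2 * n + 1)) * |y / M| ^ (2 * n + 1) =
        |y| ^ (2 * n + 1) * (1 / (N * M ^ (2 * n)) + 1 / N ^ (2 * n + 1)) := by
      rw [hR, abs_div, abs_of_pos hM, div_pow, div_pow]; field_simp; ring
    rw [mul_assoc, hconv] at hmid
    simp only [mul_sub, Finset.sum_sub_distrib] at hmid
    have hfin : C (2 * n + 1) * C 2 ^ (2 * n + 1) * U * |y| ^ (2 * n + 1) * (1 / N ^ (2 * n + 1)) ≤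
        C (2 * n + 1) * C 2 ^ (2 * n + 1) * U * |y| ^ (2 * n + 1) *
          (1 / (N * M ^ (2 * n)) + 1 / N ^ (2 * n + 1)) := by
      gcongr
      have : 0 < 1 / (N * M ^ (2 * n)) := by positivity
      linarith
    have htri := (abs_add_le _ _).trans (add_le_add (hrem.trans hfin) hmid)
    refine le_trans (le_of_eq ?_) (htri.trans (le_of_eq ?_))
    · congr 1; ring
    · ring
end

section
/- Under the setup below, with G(y) = g(x(y))·x'(y) and ϖ_k = G^{(k)}(0)/k! for 0 ≤ k ≤ 2n, one has ϖ_0 = g(γ), and for all y with |y| ≤ min(r_1, r_2, Δ M): G(y) = Σ_{k=0}^{2n} ϖ_k y^k + O( U |y|^{2n+1} ( 1/M^{2n+1} + 1/N^{2n+1} ) ), with implied constant depending only on n and C_0, …, C_{2n+3}. -/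
/-- `F` is `C^m` on `s` with all derivatives up to order `m` bounded by `A`. -/
def WBd (m : ℕ) (s : Set ℝ) (A : ℝ) (F : ℝ → ℝ) : Prop :=
  ContDiffOn ℝ m F s ∧ ∀ k ≤ m, ∀ x ∈ s, |iteratedDerivWithin k F s x| ≤ A

theorem WBd.mono {m : ℕ} {s : Set ℝ} {A B : ℝ} {F : ℝ → ℝ} (h : WBd m s A F) (hAB : A ≤ B) :
    WBd m s B F := ⟨h.1, fun k hk x hx => (h.2 k hk x hx).trans hAB⟩

theorem WBd.congr {m : ℕ} {s : Set ℝ} {A : ℝ} {F G : ℝ → ℝ} (h : WBd m s A F)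
    (hFG : Set.EqOn G F s) : WBd m s A G :=
  ⟨h.1.congr hFG, fun k hk x hx => by
    rw [iteratedDerivWithin_congr hFG hx]; exact h.2 k hk x hx⟩

theorem WBd.mul {m : ℕ} {s : Set ℝ} {A B : ℝ} {F G : ℝ → ℝ} (hs : UniqueDiffOn ℝ s)
    (hF : WBd m s A F) (hG : WBd m s B G) :
    WBd m s (2 ^ m * A * B) (fun x => F x * G x) := by
  refine ⟨hF.1.mul hG.1, fun k hk x hx => ?_⟩
  have hA : 0 ≤ A := (abs_nonneg _).trans (hF.2 0 (Nat.zero_le _) x hx)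
  have hB : 0 ≤ B := (abs_nonneg _).trans (hG.2 0 (Nat.zero_le _) x hx)
  have h := norm_iteratedFDerivWithin_mul_le hF.1 hG.1 hs hx (n := k) (by exact_mod_cast hk)
  simp only [norm_iteratedFDerivWithin_eq_norm_iteratedDerivWithin, Real.norm_eq_abs] at h
  refine h.trans ?_
  calc _ ≤ ∑ i ∈ Finset.range (k + 1), (k.choose i : ℝ) * A * B := by
        refine Finset.sum_le_sum fun i hi => ?_
        have hi' : i ≤ k := by simpa [Nat.lt_succ_iff] using hi
        have h1 := hF.2 i (hi'.trans hk) x hx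
        have h2 := hG.2 (k - i) ((Nat.sub_le _ _).trans hk) x hx
        gcongr
    _ = 2 ^ k * A * B := by
        rw [← Finset.sum_mul, ← Finset.sum_mul]
        have := Nat.sum_range_choose k
        rw [← Nat.cast_sum, this]; push_cast; ring
    _ ≤ _ := by
        gcongr
        norm_num

theorem WBd.comp {m : ℕ} {s t : Set ℝ} {A B : ℝ} {φ F : ℝ → ℝ} (hs : UniqueDiffOn ℝ s)
    (ht : UniqueDiffOn ℝ t) (hφ : WBd m t A φ) (hst : Set.MapsTo F s t)
    (hF : ContDiffOn ℝ m F s) (hB1 : 1 ≤ B)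
    (hB : ∀ k, 1 ≤ k → k ≤ m → ∀ x ∈ s, |iteratedDerivWithin k F s x| ≤ B) :
    WBd m s (m.factorial * A * B ^ m) (fun x => φ (F x)) := by
  refine ⟨hφ.1.comp hF hst, fun k hk x hx => ?_⟩
  have hA : 0 ≤ A := (abs_nonneg _).trans (hφ.2 0 (Nat.zero_le _) (F x) (hst hx))
  have h := norm_iteratedFDerivWithin_comp_le hφ.1 hF (n := k) (by exact_mod_cast hk) ht hs hst hx
    (C := A) (D := B) (fun i hi => by
      rw [norm_iteratedFDerivWithin_eq_norm_iteratedDerivWithin]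
      exact hφ.2 i (hi.trans hk) _ (hst hx))
    (fun i h1 hi => by
      rw [norm_iteratedFDerivWithin_eq_norm_iteratedDerivWithin]
      refine (hB i h1 (hi.trans hk) x hx).trans ?_
      exact le_self_pow₀ hB1 (by omega))
  rw [norm_iteratedFDerivWithin_eq_norm_iteratedDerivWithin, Real.norm_eq_abs] at h
  refine h.trans ?_
  gcongr

theorem WBd.of_contDiffOn {m : ℕ} {c d : ℝ} {φ : ℝ → ℝ} (hcd : c < d)
    (hφ : ContDiffOn ℝ m φ (Set.Icc c d)) : ∃ A, 0 < A ∧ WBd m (Set.Icc c d) A φ := by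
  have key : ∀ k : ℕ, ∃ A, k ≤ m → ∀ x ∈ Set.Icc c d,
      |iteratedDerivWithin k φ (Set.Icc c d) x| ≤ A := by
    intro k
    by_cases hk : k ≤ m
    · have hc := hφ.continuousOn_iteratedDerivWithin (m := k) (by exact_mod_cast hk)
        (uniqueDiffOn_Icc hcd)
      obtain ⟨A, hA⟩ := isCompact_Icc.exists_bound_of_continuousOn hc
      exact ⟨A, fun _ x hx => hA x hx⟩
    · exact ⟨0, fun h => absurd h hk⟩
  choose A hA using key
  refine ⟨1 + ∑ k ∈ Finset.range (m + 1), |A k|, by positivity, hφ, fun k hk x hx => ?_⟩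
  refine (hA k hk x hx).trans ((le_abs_self _).trans ?_)
  have := Finset.single_le_sum (f := fun k => |A k|) (fun i _ => abs_nonneg _)
    (Finset.mem_range.2 (Nat.lt_succ_of_le hk))
  linarith

/-- Regularity and bounds for solutions of the autonomous ODE. -/
theorem ode_bound (P : ℝ) (m : ℕ) : ∃ D : ℝ, 1 ≤ D ∧
    ∀ (s J : Set ℝ) (p x : ℝ → ℝ), UniqueDiffOn ℝ s → UniqueDiffOn ℝ J → WBd m s P p →
      Set.MapsTo x J s → (∀ y ∈ J, HasDerivWithinAt x (p (x y)) J y) →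
      ContDiffOn ℝ (m + 1 : ℕ) x J ∧
      ∀ k, 1 ≤ k → k ≤ m + 1 → ∀ y ∈ J, |iteratedDerivWithin k x J y| ≤ D := by
  suffices H : ∀ j ≤ m, ∃ D : ℝ, 1 ≤ D ∧
    ∀ (s J : Set ℝ) (p x : ℝ → ℝ), UniqueDiffOn ℝ s → UniqueDiffOn ℝ J → WBd m s P p →
      Set.MapsTo x J s → (∀ y ∈ J, HasDerivWithinAt x (p (x y)) J y) →
      ContDiffOn ℝ (j + 1 : ℕ) x J ∧
      ∀ k, 1 ≤ k → k ≤ j + 1 → ∀ y ∈ J, |iteratedDerivWithin k x J y| ≤ D from H m le_rfl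
  have step : ∀ (j : ℕ) (J : Set ℝ) (q x : ℝ → ℝ), UniqueDiffOn ℝ J → 
      (∀ y ∈ J, HasDerivWithinAt x (q y) J y) → ContDiffOn ℝ j q J →
      ContDiffOn ℝ (j + 1 : ℕ) x J := by
    intro j J q x hJ hx hq
    have : ((j + 1 : ℕ) : WithTop ℕ∞) = (j : WithTop ℕ∞) + 1 := by push_cast; rfl
    rw [this, contDiffOn_succ_iff_derivWithin hJ]
    refine ⟨fun y hy => (hx y hy).differentiableWithinAt, fun h => by simp at h, ?_⟩
    exact hq.congr fun y hy => (hx y hy).derivWithin (hJ y hy)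
  intro j
  induction j with
  | zero =>
    intro _
    refine ⟨max 1 P, le_max_left _ _, fun s J p x hs hJ hp hxs hx => ⟨?_, ?_⟩⟩
    · refine step 0 J _ x hJ hx ?_
      have : ContinuousOn x J := fun y hy => (hx y hy).continuousWithinAt
      exact contDiffOn_zero.2 (hp.1.continuousOn.comp this hxs)
    · intro k h1 hk y hy
      obtain rfl : k = 1 := by omega
      rw [iteratedDerivWithin_one, (hx y hy).derivWithin (hJ y hy)]
      have := hp.2 0 (Nat.zero_le _) (x y) (hxs hy)
      rw [iteratedDerivWithin_zero] at this
      exact this.trans (le_max_right _ _)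
  | succ j ih =>
    intro hj
    obtain ⟨D, hD1, hD⟩ := ih (by omega)
    refine ⟨max D ((j+1).factorial * P * D ^ (j+1)), le_max_of_le_left hD1,
      fun s J p x hs hJ hp hxs hx => ?_⟩
    obtain ⟨hc, hb⟩ := hD s J p x hs hJ hp hxs hx
    have hp' : WBd (j + 1) s P p :=
      ⟨hp.1.of_le (by exact_mod_cast hj), fun k hk => hp.2 k (hk.trans hj)⟩
    have hcomp := hp'.comp hJ hs hxs hc hD1 hb
    refine ⟨step (j + 1) J _ x hJ hx hcomp.1, fun k h1 hk y hy => ?_⟩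
    obtain ⟨k, rfl⟩ : ∃ k', k = k' + 1 := ⟨k - 1, by omega⟩
    rw [iteratedDerivWithin_succ', iteratedDerivWithin_congr
      (g := fun y => p (x y)) (fun y hy => (hx y hy).derivWithin (hJ y hy)) hy]
    exact (hcomp.2 k (by omega) y hy).trans (le_max_right _ _)

theorem taylor_bound (m : ℕ) : ∀ (a b B : ℝ) (H : ℝ → ℝ), a < 0 → 0 < b →
    ContDiffOn ℝ m H (Set.Icc a b) →
    (∀ x ∈ Set.Icc a b, |iteratedDerivWithin m H (Set.Icc a b) x| ≤ B) →
    ∀ y ∈ Set.Icc a b, |H y - ∑ k ∈ Finset.range m,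
      iteratedDerivWithin k H (Set.Icc a b) 0 / (Nat.factorial k : ℝ) * y ^ k| ≤ B * |y| ^ m := by
  induction m with
  | zero =>
    intro a b B H ha hb _ hB y hy
    simpa using hB y hy
  | succ m ih =>
    intro a b B H ha hb hH hB y hy
    have hab : a < b := ha.trans hb
    have hJ := uniqueDiffOn_Icc hab
    have h0 : (0:ℝ) ∈ Set.Icc a b := ⟨ha.le, hb.le⟩
    have hB0 : 0 ≤ B := (abs_nonneg _).trans (hB 0 h0)
    have hH' : ContDiffOn ℝ ((m : WithTop ℕ∞) + 1) H (Set.Icc a b) := by exact_mod_cast hH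
    rw [contDiffOn_succ_iff_derivWithin hJ] at hH'
    obtain ⟨hd, -, hc⟩ := hH'
    have IH := ih a b B (derivWithin H (Set.Icc a b)) ha hb hc (by
      intro x hx; rw [← iteratedDerivWithin_succ']; exact hB x hx)
    simp only [← iteratedDerivWithin_succ'] at IH
    have hsub : Set.uIcc 0 y ⊆ Set.Icc a b := Set.uIcc_subset_Icc h0 hy
    have hder : ∀ x ∈ Set.uIcc 0 y, HasDerivWithinAt (fun y => H y - ∑ k ∈ Finset.range (m+1),
        iteratedDerivWithin k H (Set.Icc a b) 0 / (Nat.factorial k : ℝ) * y ^ k)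
        (derivWithin H (Set.Icc a b) x - ∑ k ∈ Finset.range m,
        iteratedDerivWithin (k+1) H (Set.Icc a b) 0 / (Nat.factorial k : ℝ) * x ^ k)
        (Set.uIcc 0 y) x := by
      intro x hx
      refine (((hd x (hsub hx)).hasDerivWithinAt).mono hsub).sub ?_
      have h1 : HasDerivAt (fun y => ∑ k ∈ Finset.range (m+1),
        iteratedDerivWithin k H (Set.Icc a b) 0 / (Nat.factorial k : ℝ) * y ^ k)
        (∑ k ∈ Finset.range (m+1),
        iteratedDerivWithin k H (Set.Icc a b) 0 / (Nat.factorial k : ℝ) * ((k : ℝ) * x ^ (k-1))) x :=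
        HasDerivAt.fun_sum fun k _ => (hasDerivAt_pow k x).const_mul _
      rw [Finset.sum_range_succ'] at h1
      refine (h1.congr_deriv ?_).hasDerivWithinAt
      simp only [Nat.cast_zero, zero_mul, mul_zero, add_zero, Nat.add_sub_cancel]
      refine Finset.sum_congr rfl fun k _ => ?_
      rw [Nat.factorial_succ]
      push_cast
      have : (k.factorial : ℝ) ≠ 0 := by positivity
      field_simp
    have hbd := Convex.norm_image_sub_le_of_norm_hasDerivWithin_le hder (C := B * |y| ^ m)
      (fun x hx => by
        refine (IH x (hsub hx)).trans ?_
        have : |x| ≤ |y| := by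
          have := Set.abs_sub_left_of_mem_uIcc hx
          simpa using this
        gcongr) (convex_uIcc 0 y) Set.left_mem_uIcc Set.right_mem_uIcc
    have hz : (∑ k ∈ Finset.range (m+1),
        iteratedDerivWithin k H (Set.Icc a b) 0 / (Nat.factorial k : ℝ) * (0:ℝ) ^ k) = H 0 := by
      rw [Finset.sum_range_succ']
      simp
    rw [hz, sub_self, sub_zero, sub_zero, Real.norm_eq_abs, Real.norm_eq_abs] at hbd
    refine hbd.trans (le_of_eq ?_)
    rw [pow_succ]; ring

theorem scaling (k : ℕ) : ∀ (s s' : Set ℝ) (c : ℝ) (F : ℝ → ℝ), UniqueDiffOn ℝ s →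
    UniqueDiffOn ℝ s' → Set.MapsTo (fun v => c * v) s' s → ContDiffOn ℝ k F s →
    ∀ v ∈ s', iteratedDerivWithin k (fun v => F (c * v)) s' v =
      c ^ k * iteratedDerivWithin k F s (c * v) := by
  induction k with
  | zero => intro s s' c F _ _ _ _ v _; simp
  | succ k ih =>
    intro s s' c F hs hs' hm hF v hv
    have hF' : ContDiffOn ℝ ((k : WithTop ℕ∞) + 1) F s := by exact_mod_cast hF
    rw [contDiffOn_succ_iff_derivWithin hs] at hF'
    obtain ⟨hd, -, hc⟩ := hF'
    have : Set.EqOn (derivWithin (fun v => F (c * v)) s')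
        (fun v => c * derivWithin F s (c * v)) s' := by
      intro w hw
      have h1 := (hd (c * w) (hm hw)).hasDerivWithinAt
      have h2 : HasDerivWithinAt (fun v => c * v) c s' w := by
        simpa using ((hasDerivAt_id w).const_mul c).hasDerivWithinAt
      have h3 := (h1.comp w h2 hm).derivWithin (hs' w hw)
      simp only [Function.comp_def] at h3
      rw [h3, mul_comm]
    rw [iteratedDerivWithin_succ', iteratedDerivWithin_congr this hv,
      iteratedDerivWithin_const_mul_field, ih s s' c _ hs hs' hm hc v hv, iteratedDerivWithin_succ']
    ring

theorem exists_extension (m : ℕ) : ∀ (a b : ℝ) (F : ℝ → ℝ), a < b →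
    ContDiffOn ℝ m F (Set.Icc a b) →
    ∃ E : ℝ → ℝ, ContDiff ℝ m E ∧ Set.EqOn E F (Set.Icc a b) := by
  induction m with
  | zero =>
    intro a b F hab hF
    refine ⟨Set.IccExtend hab.le ((Set.Icc a b).domRestrict F), ?_, ?_⟩
    · exact contDiff_zero.2 ((continuousOn_iff_continuous_domRestrict.1 hF.continuousOn).Icc_extend')
    · intro x hx
      rw [Set.IccExtend_of_mem _ _ hx]; rfl
  | succ m ih =>
    intro a b F hab hF
    have hJ := uniqueDiffOn_Icc hab
    have hF' : ContDiffOn ℝ ((m : WithTop ℕ∞) + 1) F (Set.Icc a b) := by exact_mod_cast hF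
    rw [contDiffOn_succ_iff_derivWithin hJ] at hF'
    obtain ⟨hd, -, hc⟩ := hF'
    obtain ⟨D, hD, hDe⟩ := ih a b _ hab hc
    have hder : ∀ x, HasDerivAt (fun x => F a + ∫ t in a..x, D t) (D x) x := fun x =>
      (intervalIntegral.integral_hasDerivAt_right (hD.continuous.intervalIntegrable _ _)
        (hD.continuous.stronglyMeasurableAtFilter _ _) hD.continuous.continuousAt).const_add _
    refine ⟨fun x => F a + ∫ t in a..x, D t, ?_, ?_⟩
    · have : ((m + 1 : ℕ) : WithTop ℕ∞) = (m : WithTop ℕ∞) + 1 := by push_cast; rfl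
      rw [this, contDiff_succ_iff_deriv]
      refine ⟨fun x => (hder x).differentiableAt, fun h => by simp at h, ?_⟩
      have : deriv (fun x => F a + ∫ t in a..x, D t) = D := funext fun x => (hder x).deriv
      rw [this]; exact hD
    · intro x hx
      have := Convex.norm_image_sub_le_of_norm_hasDerivWithin_le (s := Set.Icc a b)
        (f := fun x => (F a + ∫ t in a..x, D t) - F x) (f' := fun _ => 0) (C := 0)
        (x := a) (y := x) (fun x hx => by
          refine (((hder x).hasDerivWithinAt).sub (hd x hx).hasDerivWithinAt).congr_deriv ?_
          rw [hDe hx, sub_self]) (fun x _ => by simp) (convex_Icc a b)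
          (Set.left_mem_Icc.2 hab.le) hx
      simp only [intervalIntegral.integral_same, add_zero, sub_self, sub_zero, zero_mul] at this
      have := norm_le_zero_iff.1 this
      exact sub_eq_zero.1 this

theorem param_hasDerivAt (w F : ℝ → ℝ) (γ : ℝ) (hw : Continuous w) (hF : ContDiff ℝ 1 F) (x : ℝ) :
    HasDerivAt (fun x => ∫ t in (0:ℝ)..1, w t * F (γ + t * (x - γ)))
      (∫ t in (0:ℝ)..1, (t * w t) * deriv F (γ + t * (x - γ))) x := by
  have hF' : Continuous (deriv F) := hF.continuous_deriv le_rfl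
  have hc : Continuous (fun z : ℝ × ℝ => (z.2 * w z.2) * deriv F (γ + z.2 * (z.1 - γ))) := by
    fun_prop
  obtain ⟨B, hB⟩ := ((isCompact_closedBall x 1).prod (isCompact_Icc (a := (0:ℝ)) (b := 1))).exists_bound_of_continuousOn
    hc.continuousOn
  have hFc := hF.continuous
  refine (intervalIntegral.hasDerivAt_integral_of_dominated_loc_of_deriv_le
    (F := fun x t => w t * F (γ + t * (x - γ)))
    (F' := fun x t => (t * w t) * deriv F (γ + t * (x - γ)))
    (s := Metric.closedBall x 1) (bound := fun _ => B)
    (Metric.closedBall_mem_nhds x one_pos) ?_ ?_ ?_ ?_ ?_ ?_).2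
  · refine Filter.Eventually.of_forall fun y => ?_
    have : Continuous (fun t => w t * F (γ + t * (y - γ))) := by fun_prop
    exact this.aestronglyMeasurable
  · have : Continuous (fun t => w t * F (γ + t * (x - γ))) := by fun_prop
    exact this.intervalIntegrable _ _
  · have : Continuous (fun t => (t * w t) * deriv F (γ + t * (x - γ))) := by fun_prop
    exact this.aestronglyMeasurable
  · refine Filter.Eventually.of_forall fun t ht y hy => ?_
    rw [Set.uIoc_of_le zero_le_one] at ht
    exact hB (y, t) ⟨hy, ht.1.le, ht.2⟩
  · exact intervalIntegrable_const
  · refine Filter.Eventually.of_forall fun t ht y hy => ?_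
    have h1 : HasDerivAt F (deriv F (γ + t * (y - γ))) (γ + t * (y - γ)) :=
      (hF.differentiable (by simp) _).hasDerivAt
    have h2 : HasDerivAt (fun y => γ + t * (y - γ)) t y := by
      simpa using (((hasDerivAt_id y).sub_const γ).const_mul t).const_add γ
    have h3 := (h1.comp y h2).const_mul (w t)
    refine h3.congr_deriv (by ring)

theorem param_contDiff (γ : ℝ) (m : ℕ) : ∀ (w F : ℝ → ℝ), Continuous w → ContDiff ℝ m F →
    ContDiff ℝ m (fun x => ∫ t in (0:ℝ)..1, w t * F (γ + t * (x - γ))) ∧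
    ∀ k ≤ m, ∀ x, iteratedDeriv k (fun x => ∫ t in (0:ℝ)..1, w t * F (γ + t * (x - γ))) x =
      ∫ t in (0:ℝ)..1, (t ^ k * w t) * iteratedDeriv k F (γ + t * (x - γ)) := by
  induction m with
  | zero =>
    intro w F hw hF
    refine ⟨contDiff_zero.2 ?_, fun k hk x => ?_⟩
    · have hFc := hF.continuous
      refine intervalIntegral.continuous_parametric_intervalIntegral_of_continuous' ?_ 0 1
      unfold Function.uncurry
      fun_prop
    · obtain rfl : k = 0 := by omega
      simp
  | succ m ih =>
    intro w F hw hF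
    have hcast : ((m + 1 : ℕ) : WithTop ℕ∞) = (m : WithTop ℕ∞) + 1 := by push_cast; rfl
    have hF1 : ContDiff ℝ 1 F := hF.of_le (by exact_mod_cast Nat.le_add_left 1 m)
    have hFd : ContDiff ℝ m (deriv F) := by
      rw [hcast, contDiff_succ_iff_deriv] at hF; exact hF.2.2
    have hder := param_hasDerivAt w F γ hw hF1
    obtain ⟨h1, h2⟩ := ih (fun t => t * w t) (deriv F) (by fun_prop) hFd
    have hde : deriv (fun x => ∫ t in (0:ℝ)..1, w t * F (γ + t * (x - γ))) =
      fun x => ∫ t in (0:ℝ)..1, (t * w t) * deriv F (γ + t * (x - γ)) :=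
      funext fun x => (hder x).deriv
    refine ⟨?_, fun k hk x => ?_⟩
    · rw [hcast, contDiff_succ_iff_deriv]
      refine ⟨fun x => (hder x).differentiableAt, fun h => by simp at h, ?_⟩
      rw [hde]; exact h1
    · cases k with
      | zero => simp
      | succ k =>
        rw [iteratedDeriv_succ', hde, h2 k (by omega) x, iteratedDeriv_succ']
        congr 1; ext t; ring

theorem param_WBd (γ a b A : ℝ) (m : ℕ) (w F : ℝ → ℝ) (hab : a < b) (hγ : γ ∈ Set.Icc a b)
    (hw : Continuous w)
    (hw1 : ∀ t ∈ Set.Icc (0:ℝ) 1, |w t| ≤ 1) (hF : ContDiff ℝ m F)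
    (hA : ∀ k ≤ m, ∀ x ∈ Set.Icc a b, |iteratedDeriv k F x| ≤ A) :
    WBd m (Set.Icc a b) A (fun x => ∫ t in (0:ℝ)..1, w t * F (γ + t * (x - γ))) := by
  obtain ⟨h1, h2⟩ := param_contDiff γ m w F hw hF
  refine ⟨h1.contDiffOn, fun k hk x hx => ?_⟩
  rw [iteratedDerivWithin_eq_iteratedDeriv (uniqueDiffOn_Icc hab)
    (h1.contDiffAt.of_le (by exact_mod_cast hk)) hx, h2 k hk x]
  have hA0 : 0 ≤ A := (abs_nonneg _).trans (hA k hk x hx)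
  have := intervalIntegral.norm_integral_le_of_norm_le_const (a := 0) (b := 1) (C := A)
    (f := fun t => (t ^ k * w t) * iteratedDeriv k F (γ + t * (x - γ))) (by
    intro t ht
    rw [Set.uIoc_of_le zero_le_one] at ht
    have ht' : t ∈ Set.Icc (0:ℝ) 1 := ⟨ht.1.le, ht.2⟩
    have hmem : γ + t * (x - γ) ∈ Set.Icc a b := by
      have := (convex_Icc a b).add_smul_sub_mem hγ hx ht'
      simpa using this
    rw [Real.norm_eq_abs, abs_mul, abs_mul]
    have e1 : |t ^ k| ≤ 1 := by
      rw [abs_of_nonneg (pow_nonneg ht'.1 k)]; exact pow_le_one₀ ht'.1 ht'.2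
    have e2 := hw1 t ht'
    have e3 := hA k hk _ hmem
    calc |t ^ k| * |w t| * _ ≤ 1 * 1 * A := by gcongr
      _ = A := by ring)
  simpa using this

theorem WBd.const_mul {m : ℕ} {s : Set ℝ} {A L c : ℝ} {F : ℝ → ℝ}
    (hF : WBd m s A F) (hc : |c| ≤ L) : WBd m s (L * A) (fun x => c * F x) := by
  refine ⟨contDiffOn_const.mul hF.1, fun k hk x hx => ?_⟩
  rw [iteratedDerivWithin_const_mul_field, abs_mul]
  have := hF.2 k hk x hx
  have h0 : 0 ≤ L := (abs_nonneg _).trans hc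
  gcongr

set_option maxHeartbeats 1000000 in
theorem unit_main (m : ℕ) (hm : 1 ≤ m) (c A B : ℝ) (hc : 0 < c) (hA : 0 < A) (hB : 0 < B) :
    ∃ K : ℝ, 0 < K ∧ ∀ (α β γ r1 r2 lam : ℝ) (f g xof : ℝ → ℝ),
      α < γ → γ < β → ContDiff ℝ (m + 2 : ℕ) f → deriv f γ = 0 →
      (∀ k ≤ m, ∀ x ∈ Set.Icc α β, |iteratedDeriv (k + 2) f x| ≤ A) →
      (∀ x ∈ Set.Icc α β, c ≤ iteratedDeriv 2 f x) →
      WBd m (Set.Icc α β) B g →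
      0 < r1 → 0 < r2 → lam = iteratedDeriv 2 f γ / 2 → xof 0 = γ →
      (∀ y ∈ Set.Icc (-r1) r2, xof y ∈ Set.Icc α β ∧
          f (xof y) = f γ + lam * y ^ 2 ∧
          (y < 0 → xof y < γ) ∧ (0 < y → γ < xof y)) →
      WBd m (Set.Icc (-r1) r2) K (fun y => g (xof y) * derivWithin xof (Set.Icc (-r1) r2) y) ∧
      g (xof 0) * derivWithin xof (Set.Icc (-r1) r2) 0 = g γ ∧
      ContDiffOn ℝ 1 xof (Set.Icc (-r1) r2) := by
  obtain ⟨A1, hA1, hsqrt⟩ := WBd.of_contDiffOn (m := m) (c := c ^ 2 / 4) (d := A ^ 2 + c ^ 2)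
    (φ := Real.sqrt) (by nlinarith [sq_nonneg A, sq_pos_of_pos hc]) (by
      intro x hx
      have : x ≠ 0 := by have := hx.1; have := sq_pos_of_pos hc; intro h; linarith
      exact (Real.contDiffAt_sqrt this).contDiffWithinAt)
  obtain ⟨A2, hA2, hinv⟩ := WBd.of_contDiffOn (m := m) (c := c) (d := A + c)
    (φ := fun x => x⁻¹) (by linarith) (by
      intro x hx
      have : x ≠ 0 := by have := hx.1; intro h; linarith
      exact (contDiffAt_inv ℝ this).contDiffWithinAt)
  obtain ⟨R, hR⟩ : ∃ R, R = m.factorial * A1 * (A * A + 1) ^ m := ⟨_, rfl⟩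
  obtain ⟨I, hI⟩ : ∃ I, I = m.factorial * A2 * (A + 1) ^ m := ⟨_, rfl⟩
  have hR0 : 0 < R := by rw [hR]; positivity
  have hI0 : 0 < I := by rw [hI]; positivity
  obtain ⟨P, hP⟩ : ∃ P, P = 2 * (2 ^ m * R * I) := ⟨_, rfl⟩
  have hP0 : 0 < P := by rw [hP]; positivity
  obtain ⟨D, hD1, hD⟩ := ode_bound P m
  refine ⟨m.factorial * (2 ^ m * B * P) * D ^ m, by positivity, ?_⟩
  intro α β γ r1 r2 lam f g xof hαγ hγβ hf hfγ hfb hfl hg hr1 hr2 hlam hx0 hx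
  have hs := uniqueDiffOn_Icc (hαγ.trans hγβ)
  have hJ : UniqueDiffOn ℝ (Set.Icc (-r1) r2) := uniqueDiffOn_Icc (by linarith)
  have hγs : γ ∈ Set.Icc α β := ⟨hαγ.le, hγβ.le⟩
  set F2 := iteratedDeriv 2 f with hF2
  have hF2c : ContDiff ℝ m F2 := by
    rw [hF2, iteratedDeriv_eq_iterate]
    exact ContDiff.iterate_deriv' m 2 (by exact_mod_cast hf)
  have hF2cont := hF2c.continuous
  have hdf : ContDiff ℝ (m + 1 : ℕ) (deriv f) := by
    have := ContDiff.iterate_deriv' (m + 1) 1 (f := f) (by exact_mod_cast hf)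
    simpa using this
  have hf1 : ∀ x, HasDerivAt f (deriv f x) x := fun x =>
    (hf.differentiable (by exact_mod_cast (by omega : m + 2 ≠ 0)) x).hasDerivAt
  have hf2 : ∀ x, HasDerivAt (deriv f) (F2 x) x := fun x => by
    have h1 := (hdf.differentiable (by exact_mod_cast (by omega : m + 1 ≠ 0)) x).hasDerivAt
    have h2 : F2 x = deriv (deriv f) x := by rw [hF2, iteratedDeriv_succ, iteratedDeriv_one]
    rw [h2]; exact h1
  have hF2b : ∀ k ≤ m, ∀ x ∈ Set.Icc α β, |iteratedDeriv k F2 x| ≤ A := by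
    intro k hk x hx
    have : iteratedDeriv k F2 = iteratedDeriv (k + 2) f := by
      rw [hF2]; simp only [iteratedDeriv_eq_iterate]; rw [← Function.iterate_add_apply]
    rw [this]; exact hfb k hk x hx
  obtain ⟨a, ha⟩ : ∃ a : ℝ → ℝ, a = fun x => ∫ t in (0:ℝ)..1, (fun _ => 1) t * F2 (γ + t * (x - γ)) := ⟨_, rfl⟩
  obtain ⟨q, hq⟩ : ∃ q : ℝ → ℝ, q = fun x => ∫ t in (0:ℝ)..1, (fun t => 1 - t) t * F2 (γ + t * (x - γ)) := ⟨_, rfl⟩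
  have haB : WBd m (Set.Icc α β) A a := by
    rw [ha]; exact param_WBd γ α β A m _ F2 (hαγ.trans hγβ) hγs continuous_const (by simp) hF2c hF2b
  have hqB : WBd m (Set.Icc α β) A q := by
    rw [hq]
    refine param_WBd γ α β A m _ F2 (hαγ.trans hγβ) hγs (by fun_prop) ?_ hF2c hF2b
    intro t ht
    rw [abs_of_nonneg (by linarith [ht.2])]; linarith [ht.1]
  have hqc : ContDiff ℝ m q := by
    rw [hq]; exact (param_contDiff γ m _ F2 (by fun_prop) hF2c).1
  have hline : ∀ x t : ℝ, HasDerivAt (fun t => γ + t * (x - γ)) (x - γ) t := fun x t => by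
    simpa using ((hasDerivAt_id t).mul_const (x - γ)).const_add γ
  have hae : ∀ x, (x - γ) * a x = deriv f x := by
    intro x
    have := intervalIntegral.integral_eq_sub_of_hasDerivAt (a := 0) (b := 1)
      (f := fun t => deriv f (γ + t * (x - γ))) (f' := fun t => F2 (γ + t * (x - γ)) * (x - γ))
      (fun t _ => (hf2 _).comp t (hline x t)) (Continuous.intervalIntegrable (by fun_prop) _ _)
    rw [intervalIntegral.integral_mul_const] at this
    simp only [one_mul, zero_mul, add_zero, hfγ, sub_zero, add_sub_cancel] at this
    rw [ha, ← this]; simp only [one_mul]; ring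
  have hqe : ∀ x, (x - γ) ^ 2 * q x = f x - f γ := by
    intro x
    have := intervalIntegral.integral_eq_sub_of_hasDerivAt (a := 0) (b := 1)
      (f := fun t => (1 - t) * (x - γ) * deriv f (γ + t * (x - γ)) + f (γ + t * (x - γ)))
      (f' := fun t => ((1 - t) * F2 (γ + t * (x - γ))) * (x - γ) ^ 2)
      (fun t _ => by
        have h1 : HasDerivAt (fun t : ℝ => (1 - t) * (x - γ)) (-(x - γ)) t := by
          simpa using ((hasDerivAt_id t).const_sub 1).mul_const (x - γ)
        have h2 := (h1.mul ((hf2 _).comp t (hline x t))).add ((hf1 _).comp t (hline x t))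
        refine h2.congr_deriv ?_
        simp only [Function.comp_apply]
        ring) (Continuous.intervalIntegrable (by fun_prop) _ _)
    rw [intervalIntegral.integral_mul_const] at this
    simp only [one_mul, zero_mul, add_zero, hfγ, sub_self, mul_zero, zero_add, add_sub_cancel] at this
    rw [hq, ← this]; ring
  have hmem : ∀ x ∈ Set.Icc α β, ∀ t ∈ Set.Icc (0:ℝ) 1, γ + t * (x - γ) ∈ Set.Icc α β := by
    intro x hx t ht
    have := (convex_Icc α β).add_smul_sub_mem hγs hx ht
    simpa using this
  have hal : ∀ x ∈ Set.Icc α β, c ≤ a x := by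
    intro x hx
    have := intervalIntegral.integral_mono_on (a := 0) (b := 1) (f := fun _ => c)
      (g := fun t => F2 (γ + t * (x - γ))) (μ := MeasureTheory.volume) zero_le_one
      intervalIntegrable_const
      (Continuous.intervalIntegrable (by fun_prop) _ _) (fun t ht => hfl _ (hmem x hx t ht))
    rw [ha]; simpa using this
  have hhalf : ∫ t in (0:ℝ)..1, (1 - t) = 1 / 2 := by
    rw [intervalIntegral.integral_sub (by simp) (by simp)]
    simp
    norm_num
  have hql : ∀ x ∈ Set.Icc α β, c / 2 ≤ q x := by
    intro x hx
    have := intervalIntegral.integral_mono_on (a := 0) (b := 1) (f := fun t => (1 - t) * c)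
      (g := fun t => (1 - t) * F2 (γ + t * (x - γ))) (μ := MeasureTheory.volume) zero_le_one
      (Continuous.intervalIntegrable (by fun_prop) _ _)
      (Continuous.intervalIntegrable (by fun_prop) _ _) (fun t ht => by
        have := hfl _ (hmem x hx t ht)
        have h2 : 0 ≤ 1 - t := by linarith [ht.2]
        gcongr)
    rw [intervalIntegral.integral_mul_const, hhalf] at this
    rw [hq]; simp only at this ⊢; linarith
  have hau : ∀ x ∈ Set.Icc α β, a x ≤ A := fun x hx => by
    have := haB.2 0 (Nat.zero_le _) x hx
    rw [iteratedDerivWithin_zero] at this; exact (le_abs_self _).trans this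
  have hqu : ∀ x ∈ Set.Icc α β, q x ≤ A := fun x hx => by
    have := hqB.2 0 (Nat.zero_le _) x hx
    rw [iteratedDerivWithin_zero] at this; exact (le_abs_self _).trans this
  have haγ : a γ = 2 * lam := by rw [ha, hlam]; simp; ring
  have hqγ : q γ = lam := by
    rw [hq, hlam]
    simp only [sub_self, mul_zero, add_zero]
    rw [intervalIntegral.integral_mul_const, hhalf]; ring
  have hlaml : c / 2 ≤ lam := by rw [← hqγ]; exact hql γ hγs
  have hlamu : lam ≤ A := by rw [← hqγ]; exact hqu γ hγs
  have hlam0 : 0 < lam := by linarith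
  have hlq : ∀ x ∈ Set.Icc α β, c ^ 2 / 4 ≤ lam * q x ∧ lam * q x ≤ A ^ 2 := by
    intro x hx
    have h1 := hql x hx
    have h2 := hqu x hx
    constructor
    · calc c ^ 2 / 4 = (c / 2) * (c / 2) := by ring
        _ ≤ _ := by gcongr
    · calc lam * q x ≤ A * A := by gcongr; linarith
        _ = _ := by ring
  have hlqB := hqB.const_mul (c := lam) (L := A) (by rw [abs_of_pos hlam0]; exact hlamu)
  obtain ⟨r, hr⟩ : ∃ r : ℝ → ℝ, r = fun x => Real.sqrt (lam * q x) := ⟨_, rfl⟩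
  have hrB : WBd m (Set.Icc α β) R r := by
    rw [hr, hR]
    refine hsqrt.comp hs (uniqueDiffOn_Icc (by nlinarith [sq_nonneg A, sq_pos_of_pos hc])) ?_ hlqB.1
      (by nlinarith) ?_
    · intro x hx
      have := hlq x hx
      exact ⟨this.1, by linarith [this.2, sq_nonneg c]⟩
    · intro k _ hk x hx
      exact (hlqB.2 k hk x hx).trans (by linarith)
  have hiB : WBd m (Set.Icc α β) I (fun x => (a x)⁻¹) := by
    rw [hI]
    refine hinv.comp hs (uniqueDiffOn_Icc (by linarith)) ?_ haB.1 (by linarith) ?_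
    · intro x hx
      exact ⟨hal x hx, by linarith [hau x hx]⟩
    · intro k _ hk x hx
      exact (haB.2 k hk x hx).trans (by linarith)
  have hpB : WBd m (Set.Icc α β) P (fun x => 2 * (r x * (a x)⁻¹)) := by
    rw [hP]
    exact (hrB.mul hs hiB).const_mul (by norm_num)
  have hrsq : ∀ x ∈ Set.Icc α β, r x ^ 2 = lam * q x := fun x hx => by
    rw [hr]; exact Real.sq_sqrt (by have := (hlq x hx).1; have := sq_pos_of_pos hc; linarith)
  have hrpos : ∀ x ∈ Set.Icc α β, 0 < r x := fun x hx => by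
    rw [hr]; exact Real.sqrt_pos.2 (by have := (hlq x hx).1; have := sq_pos_of_pos hc; linarith)
  have hru : ∀ x ∈ Set.Icc α β, r x ≤ R := fun x hx => by
    have := hrB.2 0 (Nat.zero_le _) x hx
    rw [iteratedDerivWithin_zero] at this; exact (le_abs_self _).trans this
  have hqd : ∀ x, HasDerivAt q (deriv q x) x := fun x =>
    (hqc.differentiable (by exact_mod_cast (by omega : m ≠ 0)) x).hasDerivAt
  have hid : ∀ x, 2 * q x + (x - γ) * deriv q x = a x := by
    intro x
    by_cases hxγ : x = γ
    · rw [hxγ, haγ, hqγ]; ring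
    · have h1 : HasDerivAt (fun x => (x - γ) ^ 2 * q x)
          (2 * (x - γ) * q x + (x - γ) ^ 2 * deriv q x) x := by
        have := (((hasDerivAt_id x).sub_const γ).pow 2).mul (hqd x)
        refine this.congr_deriv ?_
        simp
      have h2 : HasDerivAt (fun x => (x - γ) ^ 2 * q x) (deriv f x) x := by
        have : (fun x => (x - γ) ^ 2 * q x) = fun x => f x - f γ := funext hqe
        rw [this]; exact (hf1 x).sub_const _
      have h3 := h1.unique h2
      rw [← hae x] at h3
      have h4 : x - γ ≠ 0 := sub_ne_zero.2 hxγ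
      apply mul_left_cancel₀ h4
      linarith
  obtain ⟨h, hh⟩ : ∃ h : ℝ → ℝ, h = fun x => (x - γ) * r x / lam := ⟨_, rfl⟩
  have hhd : ∀ x ∈ Set.Icc α β, HasDerivAt h (a x / (2 * r x)) x := by
    intro x hx
    have hr0 := hrpos x hx
    have hne : lam * q x ≠ 0 := by rw [← hrsq x hx]; positivity
    have h1 : HasDerivAt r (lam * deriv q x / (2 * r x)) x := by
      rw [hr]; exact ((hqd x).const_mul lam).sqrt hne
    have h2 := (((hasDerivAt_id x).sub_const γ).mul h1).div_const lam
    rw [hh]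
    refine h2.congr_deriv ?_
    simp only [id, one_mul]
    rw [← hid x]
    have h3 := hrsq x hx
    field_simp
    rw [h3]; ring
  have hhx : ∀ y ∈ Set.Icc (-r1) r2, h (xof y) = y := by
    intro y hy
    obtain ⟨hxs, hfx, hneg, hpos⟩ := hx y hy
    have hr0 := hrpos _ hxs
    have hsq : h (xof y) ^ 2 = y ^ 2 := by
      rw [hh]
      have h1 := hrsq _ hxs
      have h2 := hqe (xof y)
      rw [hfx] at h2
      simp only
      rw [div_pow, mul_pow, h1]
      field_simp
      linarith
    rcases lt_trichotomy y 0 with hy0 | hy0 | hy0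
    · have h1 : h (xof y) < 0 := by
        rw [hh]
        exact div_neg_of_neg_of_pos (mul_neg_of_neg_of_pos (by linarith [hneg hy0]) hr0) hlam0
      rcases sq_eq_sq_iff_eq_or_eq_neg.1 hsq with e | e
      · exact e
      · linarith
    · rw [hy0, hx0, hh]; simp
    · have h1 : 0 < h (xof y) := by
        rw [hh]
        exact div_pos (mul_pos (by linarith [hpos hy0]) hr0) hlam0
      rcases sq_eq_sq_iff_eq_or_eq_neg.1 hsq with e | e
      · exact e
      · linarith
  have hmono : ∀ u ∈ Set.Icc α β, ∀ v ∈ Set.Icc α β, u ≤ v →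
      c / (2 * R) * (v - u) ≤ h v - h u := by
    refine Convex.mul_sub_le_image_sub_of_le_deriv (convex_Icc α β)
      (fun x hx => (hhd x hx).continuousAt.continuousWithinAt)
      (fun x hx => (hhd x (interior_subset hx)).differentiableAt.differentiableWithinAt) ?_
    intro x hx
    have hx := interior_subset hx
    rw [(hhd x hx).deriv]
    have h1 := hal x hx
    have h2 := hru x hx
    have h3 := hrpos x hx
    have h4 : 0 ≤ a x := hc.le.trans h1
    gcongr
  have hδ : 0 < c / (2 * R) := by positivity
  have hlip : ∀ y ∈ Set.Icc (-r1) r2, ∀ z ∈ Set.Icc (-r1) r2,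
      |xof y - xof z| ≤ (c / (2 * R))⁻¹ * |y - z| := by
    intro y hy z hz
    rw [inv_mul_eq_div, le_div_iff₀ hδ, mul_comm]
    rcases le_total (xof y) (xof z) with hle | hle
    · have := hmono _ (hx y hy).1 _ (hx z hz).1 hle
      rw [hhx y hy, hhx z hz] at this
      rw [abs_sub_comm, abs_of_nonneg (by linarith), abs_sub_comm]
      exact this.trans (le_abs_self _)
    · have := hmono _ (hx z hz).1 _ (hx y hy).1 hle
      rw [hhx y hy, hhx z hz] at this
      rw [abs_of_nonneg (by linarith)]
      exact this.trans (le_abs_self _)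
  have hxcont : ContinuousOn xof (Set.Icc (-r1) r2) := by
    have : LipschitzOnWith (Real.toNNReal (c / (2 * R))⁻¹) xof (Set.Icc (-r1) r2) := by
      refine LipschitzOnWith.of_dist_le_mul fun y hy z hz => ?_
      rw [Real.coe_toNNReal _ (by positivity), Real.dist_eq, Real.dist_eq]
      exact hlip y hy z hz
    exact this.continuousOn
  have hxd : ∀ y ∈ Set.Icc (-r1) r2,
      HasDerivWithinAt xof (2 * (r (xof y) * (a (xof y))⁻¹)) (Set.Icc (-r1) r2) y := by
    intro y hy
    have hxs := (hx y hy).1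
    have h1 := hrpos _ hxs
    have h2 : 0 < a (xof y) := hc.trans_le (hal _ hxs)
    have hne : a (xof y) / (2 * r (xof y)) ≠ 0 := by positivity
    have h3 := ((hhd _ hxs).hasFDerivAt_equiv hne).hasFDerivWithinAt (s := Set.univ)
    have h4 := h3.of_local_left_inverse (g := xof) (s := Set.Icc (-r1) r2) (a := y)
      (by rw [nhdsWithin_univ]; exact hxcont y hy) hy
      (by filter_upwards [self_mem_nhdsWithin] with z hz using hhx z hz)
    refine h4.hasDerivWithinAt.congr_deriv ?_
    simp
    field_simp
  obtain ⟨hxC, hxb⟩ := hD _ _ _ xof hs hJ hpB (fun y hy => (hx y hy).1) hxd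
  have hGe : Set.EqOn (fun y => g (xof y) * derivWithin xof (Set.Icc (-r1) r2) y)
      (fun y => (fun x => g x * (2 * (r x * (a x)⁻¹))) (xof y)) (Set.Icc (-r1) r2) := by
    intro y hy
    simp only
    rw [(hxd y hy).derivWithin (hJ y hy)]
  refine ⟨WBd.congr ?_ hGe, ?_, hxC.of_le (by exact_mod_cast Nat.le_add_left 1 m)⟩
  · exact (hg.mul hs hpB).comp hJ hs (fun y hy => (hx y hy).1)
      (hxC.of_le (by exact_mod_cast Nat.le_succ m)) hD1 (fun k h1 hk => hxb k h1 (by omega))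
  · have h0 : (0:ℝ) ∈ Set.Icc (-r1) r2 := ⟨by linarith, hr2.le⟩
    have := hGe h0
    simp only at this
    rw [this, hx0, haγ, hr]
    simp only
    rw [hqγ, Real.sqrt_mul_self hlam0.le]
    field_simp

set_option maxHeartbeats 1000000 in
/-- expansion (2.27) of the paper: under the phase and weight setup, with
`G(y) = g(x(y))·x'(y)` and `ϖ_k = G^{(k)}(0)/k!`, one has `ϖ₀ = g(γ)` and, for
`|y| ≤ min(r₁, r₂, ΔM)`,
`G(y) = Σ_{k=0}^{2n} ϖ_k y^k + O(U|y|^{2n+1}(1/M^{2n+1} + 1/N^{2n+1}))`,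
with implied constant depending only on `n` and `C₀,…,C_{2n+3}`. -/
theorem weighted_stationary_phase_stmt11
    (n : ℕ) (hn : 2 ≤ n) (C : ℕ → ℝ) (hC : ∀ k, 0 < C k) :
    ∃ K : ℝ, 0 < K ∧
      ∀ (α β γ M N T U r1 r2 : ℝ) (f g xof : ℝ → ℝ),
        α < γ → γ < β → 0 < M → 0 < N → 0 < T → 0 < U → β - α ≤ M →
        ContDiffOn ℝ (2 * n + 3) f (Set.Icc α β) →
        ContDiffOn ℝ (2 * n + 1) g (Set.Icc α β) →
        derivWithin f (Set.Icc α β) γ = 0 →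
        (∀ r, 2 ≤ r → r ≤ 2 * n + 3 → ∀ x ∈ Set.Icc α β,
          |iteratedDerivWithin r f (Set.Icc α β) x| ≤ C r * T / M ^ r) →
        (∀ x ∈ Set.Icc α β,
          T / (C 2 * M ^ 2) ≤ iteratedDerivWithin 2 f (Set.Icc α β) x) →
        (∀ s, s ≤ 2 * n + 1 → ∀ x ∈ Set.Icc α β,
          |iteratedDerivWithin s g (Set.Icc α β) x| ≤ C s * U / N ^ s) →
        let lam2 : ℝ := iteratedDerivWithin 2 f (Set.Icc α β) γ / 2
        let Δ : ℝ := min (Real.log 2 / C 2)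
          (1 / ((C 2) ^ 2 *
            (Finset.Icc 2 (2 * n + 3)).sup' (Finset.nonempty_Icc.mpr (by omega)) C))
        0 < r1 → 0 < r2 →
        f α = f γ + lam2 * r1 ^ 2 →
        f β = f γ + lam2 * r2 ^ 2 →
        xof 0 = γ →
        (∀ y ∈ Set.Icc (-r1) r2, xof y ∈ Set.Icc α β ∧
          f (xof y) = f γ + lam2 * y ^ 2 ∧
          (y < 0 → xof y < γ) ∧ (0 < y → γ < xof y)) →
        let G : ℝ → ℝ := fun y => g (xof y) * derivWithin xof (Set.Icc (-r1) r2) y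
        let ϖ : ℕ → ℝ := fun k =>
          iteratedDerivWithin k G (Set.Icc (-r1) r2) 0 / (Nat.factorial k : ℝ)
        ϖ 0 = g γ ∧
          ∀ y : ℝ, |y| ≤ min r1 (min r2 (Δ * M)) →
            |G y - ∑ k ∈ Finset.range (2 * n + 1), ϖ k * y ^ k| ≤
              K * (U * |y| ^ (2 * n + 1) * (1 / M ^ (2 * n + 1) + 1 / N ^ (2 * n + 1))) := by
  obtain ⟨S, hS⟩ : ∃ S, S = ∑ k ∈ Finset.range (2 * n + 4), C k := ⟨_, rfl⟩
  have hCS : ∀ k ≤ 2 * n + 3, C k ≤ S := by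
    intro k hk
    rw [hS]
    exact Finset.single_le_sum (fun i _ => (hC i).le) (Finset.mem_range.2 (by omega))
  have hS0 : 0 < S := (hC 0).trans_le (hCS 0 (by omega))
  obtain ⟨K, hK, hmain⟩ := unit_main (2 * n + 1) (by omega) (1 / C 2) S S
    (one_div_pos.2 (hC 2)) hS0 hS0
  refine ⟨K, hK, ?_⟩
  intro α β γ M N T U r1 r2 f g xof hαγ hγβ hM hN hT hU hMle hf hg hfγ hfb hfl hgb lam2 Δ
    hr1 hr2 hfα hfβ hx0 hx G ϖ
  obtain ⟨L, hL⟩ : ∃ L, L = min M N := ⟨_, rfl⟩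
  have hL0 : 0 < L := by rw [hL]; exact lt_min hM hN
  have hLM : L ≤ M := by rw [hL]; exact min_le_left _ _
  have hLN : L ≤ N := by rw [hL]; exact min_le_right _ _
  have hαβ : α < β := hαγ.trans hγβ
  have hs := uniqueDiffOn_Icc hαβ
  have hs' : UniqueDiffOn ℝ (Set.Icc (α / L) (β / L)) := uniqueDiffOn_Icc (by gcongr)
  have hJ : UniqueDiffOn ℝ (Set.Icc (-r1) r2) := uniqueDiffOn_Icc (by linarith)
  have hJ' : UniqueDiffOn ℝ (Set.Icc (-(r1 / L)) (r2 / L)) := uniqueDiffOn_Icc (by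
    have : 0 < r1 / L := by positivity
    have : 0 < r2 / L := by positivity
    linarith)
  have hγs : γ ∈ Set.Icc α β := ⟨hαγ.le, hγβ.le⟩
  have hmap : ∀ u ∈ Set.Icc (α / L) (β / L), L * u ∈ Set.Icc α β := by
    intro u hu
    have h1 := hu.1
    have h2 := hu.2
    rw [div_le_iff₀ hL0] at h1
    rw [le_div_iff₀ hL0] at h2
    exact ⟨by linarith, by linarith⟩
  have hmapJ : ∀ v ∈ Set.Icc (-(r1 / L)) (r2 / L), L * v ∈ Set.Icc (-r1) r2 := by
    intro v hv
    have h1 := hv.1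
    have h2 := hv.2
    rw [← neg_div, div_le_iff₀ hL0] at h1
    rw [le_div_iff₀ hL0] at h2
    exact ⟨by linarith, by linarith⟩
  have hmapJ' : ∀ y ∈ Set.Icc (-r1) r2, L⁻¹ * y ∈ Set.Icc (-(r1 / L)) (r2 / L) := by
    intro y hy
    rw [inv_mul_eq_div, ← neg_div]
    exact ⟨div_le_div_of_nonneg_right hy.1 hL0.le, div_le_div_of_nonneg_right hy.2 hL0.le⟩
  have hf' : ContDiffOn ℝ (2 * n + 1 + 2 : ℕ) f (Set.Icc α β) := by exact_mod_cast hf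
  have hg' : ContDiffOn ℝ (2 * n + 1 : ℕ) g (Set.Icc α β) := by exact_mod_cast hg
  obtain ⟨E, hE, hEf⟩ := exists_extension _ α β f hαβ hf'
  have hEd : ∀ k ≤ 2 * n + 3, ∀ x ∈ Set.Icc α β,
      iteratedDeriv k E x = iteratedDerivWithin k f (Set.Icc α β) x := by
    intro k hk x hx
    rw [← iteratedDerivWithin_congr hEf hx, iteratedDerivWithin_eq_iteratedDeriv hs
      (hE.contDiffAt.of_le (by exact_mod_cast hk)) hx]
  obtain ⟨κ, hκ⟩ : ∃ κ, κ = M ^ 2 / (T * L ^ 2) := ⟨_, rfl⟩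
  have hκ0 : 0 < κ := by rw [hκ]; positivity
  have hfd : ∀ k ≤ 2 * n + 3, ∀ u, iteratedDeriv k (fun u => κ * E (L * u)) u =
      κ * (L ^ k * iteratedDeriv k E (L * u)) := by
    intro k hk u
    rw [iteratedDeriv_const_mul_field,
      iteratedDeriv_comp_const_mul (hE.of_le (by exact_mod_cast hk))]
  have hLγ : L * (γ / L) = γ := by field_simp
  have hEγ : deriv E γ = 0 := by
    have := hEd 1 (by omega) γ hγs
    rwa [iteratedDeriv_one, iteratedDerivWithin_one, hfγ] at this
  obtain ⟨hW, hG0, hX1⟩ := hmain (α / L) (β / L) (γ / L) (r1 / L) (r2 / L) (κ * L ^ 2 * lam2)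
    (fun u => κ * E (L * u)) (fun u => U⁻¹ * g (L * u)) (fun v => L⁻¹ * xof (L * v))
    (by gcongr) (by gcongr) (contDiff_const.mul (hE.comp (contDiff_const.mul contDiff_id)))
    (by
      rw [← iteratedDeriv_one, hfd 1 (by omega), hLγ, iteratedDeriv_one, hEγ]; ring)
    (by
      intro k hk u hu
      rw [hfd (k + 2) (by omega), hEd (k + 2) (by omega) _ (hmap u hu), abs_mul, abs_mul,
        abs_of_pos hκ0, abs_of_pos (pow_pos hL0 _)]
      calc κ * (L ^ (k + 2) * _) ≤ κ * (L ^ (k + 2) * (C (k + 2) * T / M ^ (k + 2))) := by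
            have := hfb (k + 2) (by omega) (by omega) _ (hmap u hu)
            gcongr
        _ = C (k + 2) * (L / M) ^ k := by
            rw [hκ, div_pow]; field_simp; ring
        _ ≤ C (k + 2) * 1 := by
            have := (hC (k + 2)).le
            gcongr
            exact pow_le_one₀ (by positivity) ((div_le_one hM).2 hLM)
        _ ≤ S := by rw [mul_one]; exact hCS _ (by omega))
    (by
      intro u hu
      rw [hfd 2 (by omega), hEd 2 (by omega) _ (hmap u hu)]
      calc 1 / C 2 = κ * (L ^ 2 * (T / (C 2 * M ^ 2))) := by
            rw [hκ]; have := (hC 2).ne'; field_simp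
        _ ≤ _ := by
            have := hfl _ (hmap u hu)
            gcongr)
    (by
      refine ⟨contDiffOn_const.mul (hg'.comp (contDiff_const.mul contDiff_id).contDiffOn
        (fun u hu => hmap u hu)), ?_⟩
      intro k hk u hu
      rw [iteratedDerivWithin_const_mul_field, scaling k (Set.Icc α β) _ L g hs hs'
        (fun u hu => hmap u hu) (hg'.of_le (by exact_mod_cast hk)) u hu, abs_mul, abs_mul,
        abs_of_pos (inv_pos.2 hU), abs_of_pos (pow_pos hL0 _)]
      calc U⁻¹ * (L ^ k * _) ≤ U⁻¹ * (L ^ k * (C k * U / N ^ k)) := by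
            have := hgb k hk _ (hmap u hu)
            gcongr
        _ = C k * (L / N) ^ k := by
            rw [div_pow]; field_simp
        _ ≤ C k * 1 := by
            have := (hC k).le
            gcongr
            exact pow_le_one₀ (by positivity) ((div_le_one hN).2 hLN)
        _ ≤ S := by rw [mul_one]; exact hCS _ (by omega))
    (by positivity) (by positivity)
    (by
      rw [hfd 2 (by omega), hLγ, hEd 2 (by omega) γ hγs]
      simp only [lam2]; ring)
    (by rw [mul_zero, hx0, inv_mul_eq_div])
    (by
      intro v hv
      obtain ⟨h1, h2, h3, h4⟩ := hx _ (hmapJ v hv)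
      have hLL : ∀ z, L * (L⁻¹ * z) = z := fun z => mul_inv_cancel_left₀ hL0.ne' z
      refine ⟨?_, ?_, ?_, ?_⟩
      · rw [inv_mul_eq_div]
        exact ⟨div_le_div_of_nonneg_right h1.1 hL0.le, div_le_div_of_nonneg_right h1.2 hL0.le⟩
      · rw [hLL, hLγ, hEf h1, hEf hγs, h2]; ring
      · intro hv0
        rw [inv_mul_eq_div]
        have := h3 (mul_neg_of_pos_of_neg hL0 hv0)
        gcongr
      · intro hv0
        rw [inv_mul_eq_div]
        have := h4 (mul_pos hL0 hv0)
        gcongr)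
  have hLL : ∀ z, L * (L⁻¹ * z) = z := fun z => mul_inv_cancel_left₀ hL0.ne' z
  have hxd : ∀ y ∈ Set.Icc (-r1) r2, derivWithin xof (Set.Icc (-r1) r2) y =
      derivWithin (fun v => L⁻¹ * xof (L * v)) (Set.Icc (-(r1 / L)) (r2 / L)) (L⁻¹ * y) := by
    intro y hy
    have h1 := scaling 1 _ (Set.Icc (-r1) r2) L⁻¹ (fun v => L⁻¹ * xof (L * v)) hJ' hJ
      (fun y hy => hmapJ' y hy) (by exact_mod_cast hX1) y hy
    simp only [hLL] at h1
    rw [iteratedDerivWithin_const_mul_field, iteratedDerivWithin_one, iteratedDerivWithin_one,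
      pow_one] at h1
    exact mul_left_cancel₀ (inv_ne_zero hL0.ne') h1
  obtain ⟨H, hH⟩ : ∃ H : ℝ → ℝ, H = fun v => (fun u => U⁻¹ * g (L * u)) ((fun v => L⁻¹ * xof (L * v)) v) *
    derivWithin (fun v => L⁻¹ * xof (L * v)) (Set.Icc (-(r1 / L)) (r2 / L)) v := ⟨_, rfl⟩
  rw [← hH] at hW
  have hGH : Set.EqOn G (fun y => U * H (L⁻¹ * y)) (Set.Icc (-r1) r2) := by
    intro y hy
    simp only [G, hH]
    rw [hxd y hy, hLL, hLL]
    field_simp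
  have h0J : (0:ℝ) ∈ Set.Icc (-r1) r2 := ⟨by linarith, hr2.le⟩
  have hGc : ContDiffOn ℝ (2 * n + 1 : ℕ) G (Set.Icc (-r1) r2) := by
    refine ContDiffOn.congr ?_ hGH
    exact contDiffOn_const.mul (hW.1.comp (contDiff_const.mul contDiff_id).contDiffOn
        (fun u hu => hmapJ' u hu))
  have hGb : ∀ y ∈ Set.Icc (-r1) r2,
      |iteratedDerivWithin (2 * n + 1) G (Set.Icc (-r1) r2) y| ≤ U * (K / L ^ (2 * n + 1)) := by
    intro y hy
    rw [iteratedDerivWithin_congr hGH hy, iteratedDerivWithin_const_mul_field,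
      scaling _ _ (Set.Icc (-r1) r2) L⁻¹ H hJ' hJ (fun y hy => hmapJ' y hy) hW.1 y hy,
      abs_mul, abs_mul, abs_of_pos hU, abs_of_pos (pow_pos (inv_pos.2 hL0) _)]
    have := hW.2 _ le_rfl _ (hmapJ' y hy)
    rw [inv_pow, inv_mul_eq_div]
    gcongr
  constructor
  · have h1 : G 0 = U * H 0 := by simpa using hGH h0J
    simp only [ϖ, iteratedDerivWithin_zero, Nat.factorial_zero, Nat.cast_one, div_one]
    rw [h1, hH]
    simp only at hG0 ⊢
    rw [hG0, hLγ]
    field_simp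
  · intro y hy
    have hy1 : |y| ≤ r1 := hy.trans (min_le_left _ _)
    have hy2 : |y| ≤ r2 := hy.trans ((min_le_right _ _).trans (min_le_left _ _))
    have hyJ : y ∈ Set.Icc (-r1) r2 := ⟨(abs_le.1 hy1).1, (abs_le.1 hy2).2⟩
    have := taylor_bound (2 * n + 1) (-r1) r2 _ G (by linarith) hr2 hGc hGb y hyJ
    refine this.trans ?_
    have hLb : 1 / L ^ (2 * n + 1) ≤ 1 / M ^ (2 * n + 1) + 1 / N ^ (2 * n + 1) := by
      have h1 : 0 < 1 / M ^ (2 * n + 1) := by positivity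
      have h2 : 0 < 1 / N ^ (2 * n + 1) := by positivity
      rcases min_choice M N with h | h
      · rw [hL, h]; linarith
      · rw [hL, h]; linarith
    calc U * (K / L ^ (2 * n + 1)) * |y| ^ (2 * n + 1)
        = K * (U * |y| ^ (2 * n + 1) * (1 / L ^ (2 * n + 1))) := by ring
      _ ≤ _ := by gcongr
end
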